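/- arXiv:2406.03300 — 4 statements merged into one kernel-verified Lean document; each statement's English description precedes it below -/
import Mathlib

section
/- Let N ≥ 7 be an integer and let K ∈ ℂ[X₁,…,X_N] be a symmetric homogeneous polynomial whose partial degrees satisfy deg_k(K) ≤ k(2N−k−1) for every 1 ≤ k ≤ N. Suppose K satisfies the kinematic kernel condition K(−x, x, x₃, …, x_N) = 0 for all complex values, and the three-A₁ fusion equation: for all complex x, x₄, …, x_N, e^{2πi(N−2)/9} · ∏_{k=4}^{N} (x − e^{12πi/18} x_k)(x − e^{−16πi/18} x_k) · K(e^{4πi/18}x, e^{2πi/18}x, e^{−8πi/18}x, x₄, …, x_N) = e^{−2πi(N−2)/9} · ∏_{k=4}^{N} (x − e^{−12πi/18} x_k)(x − e^{16πi/18} x_k) · K(e^{8πi/18}x, e^{−2πi/18}x, e^{−4πi/18}x, x₄, …, x_N). Then K = 0. -/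
open MvPolynomial

/-- The `k`-th partial degree of a multivariate polynomial: the total degree of `P`
regarded as a polynomial in the first `k` variables. -/
noncomputable def partialDeg {N : ℕ} (k : ℕ) (P : MvPolynomial (Fin N) ℂ) : ℕ :=
  P.support.sup fun m => ∑ i ∈ Finset.univ.filter (fun i : Fin N => i.val < k), m i

open Polynomial in
theorem gen_ext (H : Multiset ℂ → ℂ) (m : ℕ)
    (hH : ∀ s, Multiset.card s + 1 = m → ∃ p : ℂ[X], ∀ x, p.eval x = H (x ::ₘ s))
    (E : Finset ℝ)
    (h : ∀ s : Multiset ℂ, Multiset.card s = m → (s.map norm).Nodup → (∀ r ∈ s, ‖r‖ ∉ E) → H s = 0) :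
    ∀ s, Multiset.card s = m → H s = 0 := by
  have key : ∀ u t : Multiset ℂ, Multiset.card t + Multiset.card u = m → (t.map norm).Nodup →
      (∀ r ∈ t, ‖r‖ ∉ E) → H (t + u) = 0 := by
    intro u
    induction u using Multiset.induction_on with
    | empty => intro t ht h1 h2; simpa using h t (by simpa using ht) h1 h2
    | cons a u ih =>
      intro t ht h1 h2
      rw [Multiset.card_cons] at ht
      obtain ⟨p, hp⟩ := hH (t + u) (by rw [Multiset.card_add]; omega)
      have hz : p = 0 := by
        apply Polynomial.eq_zero_of_infinite_isRoot
        let A : Finset ℝ := E ∪ (t.map norm).toFinset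
        have hinf : ((fun x : ℝ => (x : ℂ)) '' (Set.Ioi (0:ℝ) \ (A : Set ℝ))).Infinite := by
          apply Set.Infinite.image (Complex.ofReal_injective.injOn)
          exact (Set.Ioi_infinite 0).sdiff A.finite_toSet
        refine hinf.mono ?_
        rintro _ ⟨x, ⟨hx0, hxA⟩, rfl⟩
        have hn : ‖(x : ℂ)‖ = x := by
          rw [Complex.norm_real, Real.norm_of_nonneg (le_of_lt hx0)]
        have hxA' : x ∉ E ∧ x ∉ t.map norm := by
          simpa [A] using hxA
        show p.eval (x : ℂ) = 0
        rw [hp, ← Multiset.cons_add]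
        apply ih
        · rw [Multiset.card_cons]; omega
        · rw [Multiset.map_cons, Multiset.nodup_cons, hn]
          exact ⟨hxA'.2, h1⟩
        · intro r hr
          rcases Multiset.mem_cons.1 hr with rfl | hr
          · rw [hn]; exact hxA'.1
          · exact h2 r hr
      have := hp a
      rw [hz] at this
      rw [Multiset.add_cons, ← this]; simp
  intro s hs
  simpa using key s 0 (by simpa using hs) (by simp) (by simp)

/-- rotation by a power of `q` -/
noncomputable def rotW (q : ℂ) (e : ZMod 18) (r : ℂ) : ℂ := q ^ e.val * r

theorem rotW_rotW {q : ℂ} (hq : IsPrimitiveRoot q 18) (e f : ZMod 18) (r : ℂ) : rotW q e (rotW q f r) = rotW q (e + f) r := by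
  unfold rotW
  rw [← mul_assoc, ← pow_add, ZMod.val_add]
  congr 1
  conv_lhs => rw [← Nat.mod_add_div (e.val + f.val) 18, pow_add, pow_mul, hq.pow_eq_one]
  simp

theorem norm_q {q : ℂ} (hq : IsPrimitiveRoot q 18) : ‖q‖ = 1 := hq.norm'_eq_one (by norm_num)

theorem norm_rotW {q : ℂ} (hq : IsPrimitiveRoot q 18) (e : ZMod 18) (r : ℂ) : ‖rotW q e r‖ = ‖r‖ := by
  unfold rotW
  rw [norm_mul, norm_pow, norm_q hq]; simp

theorem rotW_ne {q : ℂ} (hq : IsPrimitiveRoot q 18) (e : ZMod 18) {r : ℂ} (h : r ≠ 0) : rotW q e r ≠ 0 := by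
  rw [← norm_pos_iff, norm_rotW hq]; exact norm_pos_iff.2 h

theorem rotW_inj {q : ℂ} (hq : IsPrimitiveRoot q 18) {e f : ZMod 18} {r : ℂ} (hr : r ≠ 0) (h : rotW q e r = rotW q f r) : e = f := by
  unfold rotW at h
  have := mul_right_cancel₀ hr h
  exact ZMod.val_injective 18 (hq.pow_inj (ZMod.val_lt e) (ZMod.val_lt f) this)

theorem rotW_zero (q r : ℂ) : rotW q 0 r = r := by simp [rotW]

open Polynomial in
theorem count_zeros {q : ℂ} (hq : IsPrimitiveRoot q 18) (p : ℂ[X])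
    (B : Multiset (ℂ × Finset (ZMod 18)))
    (h0 : ∀ b ∈ B, b.1 ≠ 0) (hnd : (B.map fun b => ‖b.1‖).Nodup)
    (hz : ∀ b ∈ B, ∀ e ∈ b.2, p.eval (rotW q e b.1) = 0)
    (hlt : p.natDegree < (B.map fun b => b.2.card).sum) : p = 0 := by
  have key : ∀ B : Multiset (ℂ × Finset (ZMod 18)), (∀ b ∈ B, b.1 ≠ 0) →
      (B.map fun b => ‖b.1‖).Nodup →
      ∃ S : Finset ℂ, S.card = (B.map fun b => b.2.card).sum ∧
        ∀ z ∈ S, ∃ b ∈ B, ∃ e ∈ b.2, z = rotW q e b.1 := by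
    intro B
    induction B using Multiset.induction_on with
    | empty => intro _ _; exact ⟨∅, by simp⟩
    | cons a B ih =>
      intro h0 hnd
      rw [Multiset.map_cons, Multiset.nodup_cons] at hnd
      obtain ⟨S, hS, hS'⟩ := ih (fun b hb => h0 b (Multiset.mem_cons_of_mem hb)) hnd.2
      refine ⟨S ∪ a.2.image (fun e => rotW q e a.1), ?_, ?_⟩
      · rw [Finset.card_union_of_disjoint, hS, Finset.card_image_of_injective]
        · simp [add_comm]
        · intro e f hef
          exact rotW_inj hq (h0 a (Multiset.mem_cons_self _ _)) hef
        · rw [Finset.disjoint_left]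
          intro z hz hz'
          obtain ⟨b, hb, e, he, rfl⟩ := hS' z hz
          obtain ⟨f, hf, hfe⟩ := Finset.mem_image.1 hz'
          apply hnd.1
          rw [Multiset.mem_map]
          refine ⟨b, hb, ?_⟩
          have := congrArg norm hfe
          simpa [norm_rotW hq] using this.symm
      · intro z hz
        rcases Finset.mem_union.1 hz with hz | hz
        · obtain ⟨b, hb, h⟩ := hS' z hz
          exact ⟨b, Multiset.mem_cons_of_mem hb, h⟩
        · obtain ⟨f, hf, rfl⟩ := Finset.mem_image.1 hz
          exact ⟨a, Multiset.mem_cons_self _ _, f, hf, rfl⟩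
  obtain ⟨S, hS, hS'⟩ := key B h0 hnd
  refine Polynomial.eq_zero_of_natDegree_lt_card_of_eval_eq_zero' p S ?_ (by omega)
  intro z hz'
  obtain ⟨b, hb, e, he, rfl⟩ := hS' z hz'
  exact hz b hb e he

/-- orbit configuration -/
noncomputable def orb (q r : ℂ) (m : Multiset (ZMod 18)) : Multiset ℂ := m.map fun e => rotW q e r

theorem orb_add (q r : ℂ) (m m' : Multiset (ZMod 18)) : orb q r (m + m') = orb q r m + orb q r m' :=
  Multiset.map_add _ _ _

theorem orb_zero (q r : ℂ) : orb q r {0} = {r} := by simp [orb, rotW_zero]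

theorem card_orb (q r : ℂ) (m : Multiset (ZMod 18)) : Multiset.card (orb q r m) = Multiset.card m :=
  Multiset.card_map _ _

theorem orb_rot {q : ℂ} (hq : IsPrimitiveRoot q 18) (e : ZMod 18) (r : ℂ) (m : Multiset (ZMod 18)) :
    orb q (rotW q e r) m = orb q r (m.map (· + e)) := by
  simp [orb, rotW_rotW hq, Multiset.map_map]

def mT : Multiset (ZMod 18) := {2, 1, 14}
def mT' : Multiset (ZMod 18) := {4, 17, 16}
def mB : Multiset (ZMod 18) := {0, 12}
def mC : Multiset (ZMod 18) := {0, 13}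

open Polynomial in
structure Sys (q : ℂ) (N : ℕ) (F : Multiset ℂ → ℂ) : Prop where
  hq : IsPrimitiveRoot q 18
  D1 : ∀ s, Multiset.card s + 1 = N → ∃ p : ℂ[X], p.natDegree + 1 ≤ N ∧ ∀ x, p.eval x = F (x ::ₘ s)
  D2 : ∀ a b s, Multiset.card s + 2 = N → ∃ p : ℂ[X], p.natDegree + 3 ≤ 2 * N ∧
    ∀ x, p.eval x = F (a * x ::ₘ b * x ::ₘ s)
  D3 : ∀ a b c s, Multiset.card s + 3 = N → ∃ p : ℂ[X], p.natDegree + 6 ≤ 3 * N ∧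
    ∀ x, p.eval x = F (a * x ::ₘ b * x ::ₘ c * x ::ₘ s)
  fus : ∃ c c' : ℂ, c ≠ 0 ∧ c' ≠ 0 ∧ ∀ x, x ≠ 0 → ∀ s, Multiset.card s + 3 = N →
    c * (s.map fun r => (x - rotW q 6 r) * (x - rotW q 7 r) * (x - rotW q 13 r)).prod
      * F (orb q x mT + s) =
    c' * (s.map fun r => (x - rotW q 12 r) * (x - rotW q 11 r) * (x - rotW q 5 r)).prod
      * F (orb q x mT' + s)

/-- zero configuration -/
def Zc (q : ℂ) (N : ℕ) (F : Multiset ℂ → ℂ) (t : Multiset ℂ) (m : Multiset (ZMod 18)) (r : ℂ) : Prop :=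
  ∀ (e : ZMod 18) (s : Multiset ℂ), Multiset.card (t + orb q (rotW q e r) m + s) = N →
    F (t + orb q (rotW q e r) m + s) = 0

theorem Zc.use {q : ℂ} (hq : IsPrimitiveRoot q 18) {N F t m r} (h : Zc q N F t m r)
    {m' : Multiset (ZMod 18)}
    (hm : ∃ e : ZMod 18, m.map (· + e) ≤ m') (s : Multiset ℂ) {U : Multiset ℂ}
    (hU : U = t + orb q r m' + s) (hc : Multiset.card U = N) : F U = 0 := by
  obtain ⟨e, he⟩ := hm
  obtain ⟨k, rfl⟩ := Multiset.le_iff_exists_add.1 he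
  have : U = t + orb q (rotW q e r) m + (orb q r k + s) := by
    rw [hU, orb_rot hq, orb_add]; abel
  rw [this]
  apply h
  rw [← this, hc]

theorem Sys.ext {q : ℂ} {N : ℕ} {F} (h : Sys q N F) (t : Multiset ℂ) (E : Finset ℝ)
    (hF : ∀ s : Multiset ℂ, Multiset.card (t + s) = N → (s.map norm).Nodup → (∀ r ∈ s, ‖r‖ ∉ E) →
      F (t + s) = 0) :
    ∀ s, Multiset.card (t + s) = N → F (t + s) = 0 := by
  intro s hs
  refine gen_ext (fun s => F (t + s)) (N - Multiset.card t) ?_ E ?_ s ?_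
  · intro s hs
    obtain ⟨p, -, hp⟩ := h.D1 (t + s) (by rw [Multiset.card_add]; omega)
    refine ⟨p, fun x => ?_⟩
    rw [hp, Multiset.add_cons]
  · intro s hs h1 h2
    exact hF s (by rw [Multiset.card_add]; rw [Multiset.card_add] at *; omega) h1 h2
  · rw [Multiset.card_add] at hs; omega



theorem sub_rot_ne {q : ℂ} (hq : IsPrimitiveRoot q 18) {x r : ℂ} (e : ZMod 18) (h : ‖r‖ ≠ ‖x‖) :
    x - rotW q e r ≠ 0 := by
  intro h0
  apply h
  rw [sub_eq_zero.1 h0, norm_rotW hq]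

theorem sub_rot_self_ne {q : ℂ} (hq : IsPrimitiveRoot q 18) {x : ℂ} (hx : x ≠ 0) (e f : ZMod 18)
    (h : e ≠ f) : rotW q e x - rotW q f x ≠ 0 := by
  intro h0
  exact h (rotW_inj hq hx (sub_eq_zero.1 h0))

theorem sub_rot_self_ne' {q : ℂ} (hq : IsPrimitiveRoot q 18) {x : ℂ} (hx : x ≠ 0) (f : ZMod 18)
    (h : 0 ≠ f) : x - rotW q f x ≠ 0 := by
  have := sub_rot_self_ne hq hx 0 f h
  rwa [rotW_zero] at this

theorem prod3_ne {q : ℂ} (hq : IsPrimitiveRoot q 18) {x : ℂ} (s : Multiset ℂ) (a b c : ZMod 18)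
    (h : ∀ r ∈ s, ‖r‖ ≠ ‖x‖) :
    (s.map fun r => (x - rotW q a r) * (x - rotW q b r) * (x - rotW q c r)).prod ≠ 0 := by
  apply Multiset.prod_ne_zero
  intro hz
  obtain ⟨r, hr, h0⟩ := Multiset.mem_map.1 hz
  have := h r hr
  refine absurd h0 ?_
  exact mul_ne_zero (mul_ne_zero (sub_rot_ne hq _ this) (sub_rot_ne hq _ this)) (sub_rot_ne hq _ this)

theorem Sys.fusT' {q : ℂ} {N : ℕ} {F} (h : Sys q N F) {x : ℂ} (hx : x ≠ 0) (s : Multiset ℂ)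
    (hs : Multiset.card s + 3 = N) (hn : ∀ r ∈ s, ‖r‖ ≠ ‖x‖) (hF : F (orb q x mT + s) = 0) :
    F (orb q x mT' + s) = 0 := by
  obtain ⟨c, c', hc, hc', H⟩ := h.fus
  have := H x hx s hs
  rw [hF, mul_zero] at this
  have h2 := mul_ne_zero hc' (prod3_ne h.hq s 12 11 5 hn)
  exact (mul_eq_zero.1 this.symm).resolve_left h2

theorem Sys.Z0 {q : ℂ} {N : ℕ} {F} (h : Sys q N F) (x : ℂ) (hx : x ≠ 0) (u : ZMod 18)
    (hu : u ∈ ({6, 7, 13} : Finset (ZMod 18))) (s : Multiset ℂ)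
    (hs : Multiset.card (orb q x (mT + {u}) + s) = N) : F (orb q x (mT + {u}) + s) = 0 := by
  have hq := h.hq
  refine h.ext (orb q x (mT + {u})) {0, ‖x‖} ?_ s hs
  clear hs s
  intro s hs h1 h2
  obtain ⟨c, c', hc, hc', H⟩ := h.fus
  have e1 : orb q x (mT + {u}) + s = orb q x mT + rotW q u x ::ₘ s := by
    rw [orb_add]
    have : orb q x {u} = {rotW q u x} := by simp [orb]
    rw [this, add_assoc, Multiset.singleton_add]
  rw [e1] at hs ⊢
  have hcard : Multiset.card (rotW q u x ::ₘ s) + 3 = N := by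
    rw [Multiset.card_add, card_orb] at hs
    simp [mT] at hs ⊢; omega
  have := H x hx _ hcard
  rw [Multiset.map_cons, Multiset.prod_cons, Multiset.map_cons, Multiset.prod_cons] at this
  have hgen := prod3_ne hq s 6 7 13 (x := x) (fun r hr => by
    have := h2 r hr; simp at this; exact this.2)
  have hz : (x - rotW q 12 (rotW q u x)) * (x - rotW q 11 (rotW q u x)) *
      (x - rotW q 5 (rotW q u x)) = 0 := by
    simp only [rotW_rotW hq]
    have : ∀ u ∈ ({6, 7, 13} : Finset (ZMod 18)), 12 + u = 0 ∨ 11 + u = 0 ∨ 5 + u = 0 := by decide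
    rcases this u hu with h | h | h <;> rw [h, rotW_zero] <;> ring
  have hnz : (x - rotW q 6 (rotW q u x)) * (x - rotW q 7 (rotW q u x)) *
      (x - rotW q 13 (rotW q u x)) ≠ 0 := by
    simp only [rotW_rotW hq]
    have : ∀ u ∈ ({6, 7, 13} : Finset (ZMod 18)), 0 ≠ 6 + u ∧ 0 ≠ 7 + u ∧ 0 ≠ 13 + u := by decide
    obtain ⟨a1, a2, a3⟩ := this u hu
    exact mul_ne_zero (mul_ne_zero (sub_rot_self_ne' hq hx _ a1) (sub_rot_self_ne' hq hx _ a2))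
      (sub_rot_self_ne' hq hx _ a3)
  rw [hz] at this
  have h3 : c' * (0 * (s.map fun r => (x - rotW q 12 r) * (x - rotW q 11 r) *
      (x - rotW q 5 r)).prod) * F (orb q x mT' + rotW q u x ::ₘ s) = 0 := by ring
  rw [h3] at this
  exact (mul_eq_zero.1 this).resolve_left (mul_ne_zero hc (mul_ne_zero hnz hgen))

theorem Sys.Z0c {q : ℂ} {N : ℕ} {F} (h : Sys q N F) (x : ℂ) (hx : x ≠ 0) (u : ZMod 18)
    (hu : u ∈ ({6, 7, 13} : Finset (ZMod 18))) : Zc q N F 0 (mT + {u}) x := by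
  intro e s hs
  rw [zero_add] at hs ⊢
  exact h.Z0 _ (rotW_ne h.hq _ hx) u hu s hs

/-- use of fused zeros -/
theorem Sys.Z0use {q : ℂ} {N : ℕ} {F} (h : Sys q N F) {x : ℂ} (hx : x ≠ 0)
    {m' : Multiset (ZMod 18)}
    (hm : ∃ u ∈ ({6, 7, 13} : Finset (ZMod 18)), ∃ e : ZMod 18, (mT + {u}).map (· + e) ≤ m')
    (s : Multiset ℂ) {U : Multiset ℂ} (hU : U = orb q x m' + s) (hc : Multiset.card U = N) :
    F U = 0 := by
  obtain ⟨u, hu, hm⟩ := hm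
  exact (h.Z0c x hx u hu).use h.hq hm s (by rw [zero_add, hU]) hc

open Polynomial in
theorem Sys.D3o {q : ℂ} {N : ℕ} {F} (h : Sys q N F) (a b c : ZMod 18) (s : Multiset ℂ)
    (hs : Multiset.card s + 3 = N) : ∃ p : ℂ[X], p.natDegree + 6 ≤ 3 * N ∧
    ∀ x, p.eval x = F (orb q x {a, b, c} + s) := by
  obtain ⟨p, h1, h2⟩ := h.D3 (q ^ a.val) (q ^ b.val) (q ^ c.val) s hs
  exact ⟨p, h1, fun x => by rw [h2]; simp [orb, rotW]⟩

open Polynomial in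
theorem Sys.D2o {q : ℂ} {N : ℕ} {F} (h : Sys q N F) (a b : ZMod 18) (s : Multiset ℂ)
    (hs : Multiset.card s + 2 = N) : ∃ p : ℂ[X], p.natDegree + 3 ≤ 2 * N ∧
    ∀ x, p.eval x = F (orb q x {a, b} + s) := by
  obtain ⟨p, h1, h2⟩ := h.D2 (q ^ a.val) (q ^ b.val) s hs
  exact ⟨p, h1, fun x => by rw [h2]; simp [orb, rotW]⟩

theorem chk6a : ∀ e ∈ ({14,13,8,12,7,6,1,4,5,10,11,17} : Finset (ZMod 18)),
    ∃ u ∈ ({6, 7, 13} : Finset (ZMod 18)), ∃ f : ZMod 18,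
      (mT + {u}).map (· + f) ≤ mT.map (· + e) + mT := by decide
theorem chk6b : ∀ e ∈ ({12,11,5} : Finset (ZMod 18)),
    ∃ u ∈ ({6, 7, 13} : Finset (ZMod 18)), ∃ f : ZMod 18,
      (mT + {u}).map (· + f) ≤ mT.map (· + e) + {0} := by decide

open Polynomial in
theorem eval_prod3 (q : ℂ) (s : Multiset ℂ) (a b c : ZMod 18) (x : ℂ) :
    ((s.map fun r => (Polynomial.X - Polynomial.C (rotW q a r)) * (Polynomial.X - Polynomial.C (rotW q b r)) * (Polynomial.X - Polynomial.C (rotW q c r))).prod).eval x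
    = (s.map fun r => (x - rotW q a r) * (x - rotW q b r) * (x - rotW q c r)).prod := by
  rw [Polynomial.eval_multiset_prod, Multiset.map_map]
  congr 1
  apply Multiset.map_congr rfl
  intro r _
  simp

open Polynomial in
theorem Sys.L6 {q : ℂ} {N : ℕ} {F} (h : Sys q N F) (x y : ℂ) (hy : y ≠ 0) (s : Multiset ℂ)
    (hs : Multiset.card (orb q x mT + orb q y mT + s) = N) :
    F (orb q x mT + orb q y mT + s) = 0 := by
  have hq := h.hq
  refine h.ext (orb q x mT + orb q y mT) {0, ‖y‖} ?_ s hs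
  clear hs s
  intro s hs h1 h2
  have h2' : ∀ r ∈ s, r ≠ 0 ∧ ‖r‖ ≠ ‖y‖ := fun r hr => by
    have := h2 r hr; simpa using this
  have hcard : Multiset.card s + 6 = N := by
    simp only [Multiset.card_add, card_orb] at hs
    simp [mT] at hs; omega
  have hcard' : Multiset.card (orb q y mT + s) + 3 = N := by
    simp only [Multiset.card_add, card_orb]
    simp [mT]; omega
  obtain ⟨p, hp1, hp2⟩ := h.D3o 2 1 14 (orb q y mT + s) hcard'
  obtain ⟨p', hp1', hp2'⟩ := h.D3o 4 17 16 (orb q y mT + s) hcard'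
  change ∀ x, p.eval x = F (orb q x mT + _) at hp2
  change ∀ x, p'.eval x = F (orb q x mT' + _) at hp2'
  suffices hp : p = 0 by
    have := hp2 x
    rw [add_assoc, ← this, hp]; simp
  have hdvd : (Polynomial.X - Polynomial.C (rotW q 13 y)) ^ 2 ∣ p := by
    obtain ⟨c, c', hc, hc', H⟩ := h.fus
    set Lp : ℂ[X] := ((orb q y mT + s).map fun r => (Polynomial.X - Polynomial.C (rotW q 6 r)) * (Polynomial.X - Polynomial.C (rotW q 7 r)) *
      (Polynomial.X - Polynomial.C (rotW q 13 r))).prod with hLp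
    set Rp : ℂ[X] := ((orb q y mT + s).map fun r => (Polynomial.X - Polynomial.C (rotW q 12 r)) * (Polynomial.X - Polynomial.C (rotW q 11 r)) *
      (Polynomial.X - Polynomial.C (rotW q 5 r))).prod with hRp
    have hid : Polynomial.C c * Lp * p = Polynomial.C c' * Rp * p' := by
      apply Polynomial.eq_of_infinite_eval_eq
      refine (Set.Infinite.mono ?_ (Set.finite_singleton (0:ℂ)).infinite_compl)
      intro z hz
      have := H z (by simpa using hz) _ hcard'
      rw [← hp2, ← hp2'] at this
      show eval z _ = eval z _
      rw [Polynomial.eval_mul, Polynomial.eval_mul, Polynomial.eval_mul, Polynomial.eval_mul, hLp, hRp, eval_prod3, eval_prod3, Polynomial.eval_C, Polynomial.eval_C]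
      exact this
    have hR : (Polynomial.X - Polynomial.C (rotW q 13 y)) ^ 2 ∣ Rp := by
      rw [hRp]
      simp only [orb, mT, Multiset.map_add, Multiset.prod_add, Multiset.insert_eq_cons,
        Multiset.map_cons, Multiset.map_singleton, Multiset.prod_cons, Multiset.prod_singleton,
        rotW_rotW hq]
      have e1 : (11 + 2 : ZMod 18) = 13 := by decide
      have e2 : (12 + 1 : ZMod 18) = 13 := by decide
      rw [e1, e2, pow_two]
      generalize Polynomial.X - Polynomial.C (rotW q 13 y) = A
      refine Dvd.intro (((Polynomial.X - Polynomial.C (rotW q (12+2) y)) * (Polynomial.X - Polynomial.C (rotW q (5+2) y))) *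
        ((Polynomial.X - Polynomial.C (rotW q (11+1) y)) * (Polynomial.X - Polynomial.C (rotW q (5+1) y))) * (((Polynomial.X - Polynomial.C (rotW q (12+14) y)) * (Polynomial.X - Polynomial.C (rotW q (11+14) y))) * (Polynomial.X - Polynomial.C (rotW q (5+14) y))) * (Multiset.map (fun r => (Polynomial.X - Polynomial.C (rotW q 12 r)) * (Polynomial.X - Polynomial.C (rotW q 11 r)) * (Polynomial.X - Polynomial.C (rotW q 5 r))) s).prod) ?_
      ring
    have hcop : IsCoprime ((Polynomial.X - Polynomial.C (rotW q 13 y)) ^ 2) (Polynomial.C c * Lp) := by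
      apply IsCoprime.pow_left
      rw [(Polynomial.irreducible_X_sub_C _).coprime_iff_not_dvd, Polynomial.dvd_iff_isRoot,
        Polynomial.IsRoot.def, Polynomial.eval_mul, Polynomial.eval_C, hLp, eval_prod3, Multiset.map_add, Multiset.prod_add]
      refine mul_ne_zero hc (mul_ne_zero ?_ ?_)
      · simp only [orb, mT, Multiset.insert_eq_cons,
          Multiset.map_cons, Multiset.map_singleton, Multiset.prod_cons, Multiset.prod_singleton,
          rotW_rotW hq]
        refine mul_ne_zero (mul_ne_zero (mul_ne_zero ?_ ?_) ?_) (mul_ne_zero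
          (mul_ne_zero (mul_ne_zero ?_ ?_) ?_) (mul_ne_zero (mul_ne_zero ?_ ?_) ?_)) <;>
        exact sub_rot_self_ne hq hy _ _ (by decide)
      · apply prod3_ne hq
        intro r hr
        rw [norm_rotW hq]; exact (h2' r hr).2
    refine hcop.dvd_of_dvd_mul_left ?_
    rw [hid]
    exact Dvd.dvd.mul_right (Dvd.dvd.mul_left hR _) _
  obtain ⟨k, hk⟩ := hdvd
  set p1 := (Polynomial.X - Polynomial.C (rotW q 13 y)) * k with hp1def
  have hpp : p = (Polynomial.X - Polynomial.C (rotW q 13 y)) * p1 := by rw [hk, hp1def]; ring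
  by_contra hpne
  have hp1ne : p1 ≠ 0 := by rintro h0; apply hpne; rw [hpp, h0, mul_zero]
  have hdegp : p.natDegree = 1 + p1.natDegree := by
    rw [hpp, natDegree_mul (X_sub_C_ne_zero _) hp1ne, natDegree_X_sub_C]
  apply hp1ne
  have hroot : ∀ z, p.eval z = 0 → p1.eval z = 0 := by
    intro z hz
    by_cases hzc : z = rotW q 13 y
    · rw [hzc, hp1def]; simp
    · rw [hpp, Polynomial.eval_mul] at hz
      refine (mul_eq_zero.1 hz).resolve_left ?_
      simpa [sub_eq_zero] using hzc
  refine count_zeros hq p1 ((y, {14,13,8,12,7,6,1,4,5,10,11,17}) ::ₘ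
    s.map fun r => (r, ({12,11,5} : Finset (ZMod 18)))) ?_ ?_ ?_ ?_
  · intro b hb
    rcases Multiset.mem_cons.1 hb with rfl | hb
    · exact hy
    · obtain ⟨r, hr, rfl⟩ := Multiset.mem_map.1 hb
      exact (h2' r hr).1
  · rw [Multiset.map_cons, Multiset.nodup_cons, Multiset.map_map]
    refine ⟨?_, h1⟩
    intro hmem
    obtain ⟨r, hr, he⟩ := Multiset.mem_map.1 hmem
    exact (h2' r hr).2 he
  · intro b hb e he
    apply hroot
    rw [hp2]
    rcases Multiset.mem_cons.1 hb with rfl | hb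
    · refine h.Z0use hy (chk6a e he) s ?_ ?_
      · simp only [orb_rot hq, orb_add]; abel
      · simp only [Multiset.card_add, card_orb] at *; omega
    · obtain ⟨r, hr, rfl⟩ := Multiset.mem_map.1 hb
      obtain ⟨s', rfl⟩ := Multiset.exists_cons_of_mem hr
      refine h.Z0use (h2' r hr).1 (chk6b e he) (orb q y mT + s') ?_ ?_
      · simp only [orb_rot hq, orb_add, orb_zero, ← Multiset.singleton_add]; abel
      · simp only [Multiset.card_add, card_orb] at *; omega
  · rw [Multiset.map_cons, Multiset.sum_cons, Multiset.map_map]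
    have e1 : Finset.card ({14,13,8,12,7,6,1,4,5,10,11,17} : Finset (ZMod 18)) = 12 := by decide
    have e2 : Finset.card ({12,11,5} : Finset (ZMod 18)) = 3 := by decide
    simp only [Function.comp_def, e1, e2, Multiset.map_const', Multiset.sum_replicate, smul_eq_mul]
    omega


open Polynomial in
theorem count2 {q : ℂ} (hq : IsPrimitiveRoot q 18) (p : ℂ[X])
    (x y : ℂ) (Ux Uy Us : Finset (ZMod 18)) (s : Multiset ℂ)
    (hx : x ≠ 0) (hy : y ≠ 0) (hxy : ‖x‖ ≠ ‖y‖) (hnd : (s.map norm).Nodup)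
    (hs : ∀ r ∈ s, r ≠ 0 ∧ ‖r‖ ≠ ‖x‖ ∧ ‖r‖ ≠ ‖y‖)
    (zx : ∀ e ∈ Ux, p.eval (rotW q e x) = 0) (zy : ∀ e ∈ Uy, p.eval (rotW q e y) = 0)
    (zs : ∀ r ∈ s, ∀ e ∈ Us, p.eval (rotW q e r) = 0)
    (hlt : p.natDegree < Ux.card + Uy.card + Multiset.card s * Us.card) : p = 0 := by
  refine count_zeros hq p ((x, Ux) ::ₘ (y, Uy) ::ₘ s.map fun r => (r, Us)) ?_ ?_ ?_ ?_
  · intro b hb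
    rcases Multiset.mem_cons.1 hb with rfl | hb
    · exact hx
    rcases Multiset.mem_cons.1 hb with rfl | hb
    · exact hy
    · obtain ⟨r, hr, rfl⟩ := Multiset.mem_map.1 hb
      exact (hs r hr).1
  · rw [Multiset.map_cons, Multiset.nodup_cons, Multiset.map_cons, Multiset.nodup_cons,
      Multiset.map_map]
    refine ⟨?_, ?_, hnd⟩
    · intro hmem
      rcases Multiset.mem_cons.1 hmem with h | h
      · exact hxy h
      obtain ⟨r, hr, he⟩ := Multiset.mem_map.1 h
      exact (hs r hr).2.1 he
    · intro h
      obtain ⟨r, hr, he⟩ := Multiset.mem_map.1 h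
      exact (hs r hr).2.2 he
  · intro b hb e he
    rcases Multiset.mem_cons.1 hb with rfl | hb
    · exact zx e he
    rcases Multiset.mem_cons.1 hb with rfl | hb
    · exact zy e he
    · obtain ⟨r, hr, rfl⟩ := Multiset.mem_map.1 hb
      exact zs r hr e he
  · simp only [Multiset.map_cons, Multiset.sum_cons, Multiset.map_map, Function.comp_def,
      Multiset.map_const', Multiset.sum_replicate, smul_eq_mul]
    omega

open Polynomial in
theorem count1 {q : ℂ} (hq : IsPrimitiveRoot q 18) (p : ℂ[X])
    (x : ℂ) (Ux Us : Finset (ZMod 18)) (s : Multiset ℂ)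
    (hx : x ≠ 0) (hnd : (s.map norm).Nodup)
    (hs : ∀ r ∈ s, r ≠ 0 ∧ ‖r‖ ≠ ‖x‖)
    (zx : ∀ e ∈ Ux, p.eval (rotW q e x) = 0)
    (zs : ∀ r ∈ s, ∀ e ∈ Us, p.eval (rotW q e r) = 0)
    (hlt : p.natDegree < Ux.card + Multiset.card s * Us.card) : p = 0 := by
  refine count_zeros hq p ((x, Ux) ::ₘ s.map fun r => (r, Us)) ?_ ?_ ?_ ?_
  · intro b hb
    rcases Multiset.mem_cons.1 hb with rfl | hb
    · exact hx
    · obtain ⟨r, hr, rfl⟩ := Multiset.mem_map.1 hb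
      exact (hs r hr).1
  · rw [Multiset.map_cons, Multiset.nodup_cons, Multiset.map_map]
    refine ⟨?_, hnd⟩
    intro h
    obtain ⟨r, hr, he⟩ := Multiset.mem_map.1 h
    exact (hs r hr).2 he
  · intro b hb e he
    rcases Multiset.mem_cons.1 hb with rfl | hb
    · exact zx e he
    · obtain ⟨r, hr, rfl⟩ := Multiset.mem_map.1 hb
      exact zs r hr e he
  · simp only [Multiset.map_cons, Multiset.sum_cons, Multiset.map_map, Function.comp_def,
      Multiset.map_const', Multiset.sum_replicate, smul_eq_mul]
    omega

open Polynomial in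
theorem count0 {q : ℂ} (hq : IsPrimitiveRoot q 18) (p : ℂ[X])
    (Us : Finset (ZMod 18)) (s : Multiset ℂ)
    (hnd : (s.map norm).Nodup)
    (hs : ∀ r ∈ s, r ≠ 0)
    (zs : ∀ r ∈ s, ∀ e ∈ Us, p.eval (rotW q e r) = 0)
    (hlt : p.natDegree < Multiset.card s * Us.card) : p = 0 := by
  refine count_zeros hq p (s.map fun r => (r, Us)) ?_ ?_ ?_ ?_
  · intro b hb
    obtain ⟨r, hr, rfl⟩ := Multiset.mem_map.1 hb
    exact hs r hr
  · rw [Multiset.map_map]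
    exact hnd
  · intro b hb e he
    obtain ⟨r, hr, rfl⟩ := Multiset.mem_map.1 hb
    exact zs r hr e he
  · simp only [Multiset.map_map, Function.comp_def,
      Multiset.map_const', Multiset.sum_replicate, smul_eq_mul]
    omega

/-- shifts of either triple contained in a given multiset -/
def hasT (m : Multiset (ZMod 18)) : Prop :=
  (∃ f : ZMod 18, mT.map (· + f) ≤ m) ∨ (∃ f : ZMod 18, mT'.map (· + f) ≤ m)

instance (m : Multiset (ZMod 18)) : Decidable (hasT m) := by unfold hasT; infer_instance

theorem chk_BC : ∀ e ∈ ({0,4,6,11,13,17} : Finset (ZMod 18)), hasT (mC.map (· + e) + mB) := by decide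
theorem chk_Cr : ∀ e ∈ ({6,17} : Finset (ZMod 18)), hasT (mC.map (· + e) + {0}) := by decide
theorem chk_CT : ∀ e ∈ ({6,7,13,11,12,0} : Finset (ZMod 18)),
    ∃ u ∈ ({6, 7, 13} : Finset (ZMod 18)), ∃ f : ZMod 18,
      (mT + {u}).map (· + f) ≤ mC.map (· + e) + mT := by decide
theorem chk_rB : ∀ e ∈ ({17,13} : Finset (ZMod 18)), hasT (mB + {e}) := by decide
theorem chk_rT : ∀ e ∈ ({6,7,13} : Finset (ZMod 18)),
    ∃ u ∈ ({6, 7, 13} : Finset (ZMod 18)), ∃ f : ZMod 18,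
      (mT + {u}).map (· + f) ≤ mT + {e} := by decide
theorem chk_rC : ∀ e ∈ ({5,13} : Finset (ZMod 18)), ∃ f : ZMod 18, mC.map (· + f) ≤ {0} + {e} := by
  decide
theorem chk_rrB : ∀ e ∈ ({6,12} : Finset (ZMod 18)), ∃ f : ZMod 18, mB.map (· + f) ≤ {0} + {e} := by
  decide

theorem card_mT : Multiset.card mT = 3 := rfl
theorem card_mT' : Multiset.card mT' = 3 := rfl
theorem card_mB : Multiset.card mB = 2 := rfl
theorem card_mC : Multiset.card mC = 2 := rfl

theorem orb_single (q r : ℂ) (e : ZMod 18) : orb q r {e} = {rotW q e r} := by simp [orb]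

theorem Sys.L6' {q : ℂ} {N : ℕ} {F} (h : Sys q N F) (x y : ℂ) (hy : y ≠ 0)
    (hxy : ‖x‖ ≠ ‖y‖) (s : Multiset ℂ)
    (hs : Multiset.card (orb q x mT + orb q y mT' + s) = N) :
    F (orb q x mT + orb q y mT' + s) = 0 := by
  have hq := h.hq
  refine h.ext _ {‖y‖} ?_ s hs
  clear hs s
  intro s hs h1 h2
  simp only [Multiset.card_add, card_orb, card_mT, card_mT'] at hs
  have e1 : orb q x mT + orb q y mT' + s = orb q y mT' + (orb q x mT + s) := by abel
  rw [e1]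
  apply h.fusT' hy
  · simp only [Multiset.card_add, card_orb, card_mT]; omega
  · intro r hr
    rcases Multiset.mem_add.1 hr with hr | hr
    · obtain ⟨e, he, rfl⟩ := Multiset.mem_map.1 hr
      rw [norm_rotW hq]; exact hxy
    · simpa using h2 r hr
  · have := h.L6 x y hy s (by simp only [Multiset.card_add, card_orb, card_mT]; omega)
    rw [← this]; congr 1; abel

theorem Sys.L6use {q : ℂ} {N : ℕ} {F} (h : Sys q N F) {x y : ℂ} (hy : y ≠ 0)
    (hxy : ‖x‖ ≠ ‖y‖) {m' : Multiset (ZMod 18)} (hm : hasT m') (s : Multiset ℂ) {U : Multiset ℂ}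
    (hU : U = orb q x mT + orb q y m' + s) (hc : Multiset.card U = N) : F U = 0 := by
  have hq := h.hq
  rcases hm with hm | hm
  · refine Zc.use (N := N) (t := orb q x mT) (m := mT) (r := y) hq ?_ hm s hU hc
    intro e s hs
    exact h.L6 x _ (rotW_ne hq _ hy) s hs
  · refine Zc.use (N := N) (t := orb q x mT) (m := mT') (r := y) hq ?_ hm s hU hc
    intro e s hs
    exact h.L6' x _ (rotW_ne hq _ hy) (by rwa [norm_rotW hq]) s hs

theorem Sys.L5 {q : ℂ} {N : ℕ} {F} (h : Sys q N F) (x y z : ℂ) (hx : x ≠ 0) (hy : y ≠ 0)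
    (hxy : ‖x‖ ≠ ‖y‖) (s : Multiset ℂ)
    (hs : Multiset.card (orb q x mT + orb q y mB + orb q z mC + s) = N) :
    F (orb q x mT + orb q y mB + orb q z mC + s) = 0 := by
  have hq := h.hq
  refine h.ext _ {0, ‖x‖, ‖y‖} ?_ s hs
  clear hs s
  intro s hs h1 h2
  have h2' : ∀ r ∈ s, r ≠ 0 ∧ ‖r‖ ≠ ‖x‖ ∧ ‖r‖ ≠ ‖y‖ := fun r hr => by
    have := h2 r hr; simpa using this
  simp only [Multiset.card_add, card_orb, card_mT, card_mB, card_mC] at hs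
  obtain ⟨p, hp1, hp2⟩ := h.D2o 0 13 (orb q x mT + orb q y mB + s) (by
    simp only [Multiset.card_add, card_orb, card_mT, card_mB]; omega)
  change ∀ x, p.eval x = F (orb q x mC + _) at hp2
  suffices hp : p = 0 by
    have := hp2 z
    rw [hp, Polynomial.eval_zero] at this
    rw [this]; congr 1; abel
  refine count2 hq p x y {6,7,13,11,12,0} {0,4,6,11,13,17} {6,17} s hx hy hxy h1 h2' ?_ ?_ ?_ ?_
  · intro e he
    rw [hp2]
    refine h.Z0use hx (chk_CT e he) (orb q y mB + s) ?_ ?_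
    · simp only [orb_rot hq, orb_add]; abel
    · simp only [Multiset.card_add, card_orb, card_mT, card_mB, card_mC] at *; omega
  · intro e he
    rw [hp2]
    refine h.L6use hy hxy (chk_BC e he) s ?_ ?_
    · simp only [orb_rot hq, orb_add]; abel
    · simp only [Multiset.card_add, card_orb, card_mT, card_mB, card_mC] at *; omega
  · intro r hr e he
    rw [hp2]
    obtain ⟨s', rfl⟩ := Multiset.exists_cons_of_mem hr
    refine h.L6use (h2' r hr).1 (h2' r hr).2.1.symm (chk_Cr e he) (orb q y mB + s') ?_ ?_
    · simp only [orb_rot hq, orb_add, orb_zero, ← Multiset.singleton_add]; abel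
    · simp only [Multiset.card_add, card_orb, card_mT, card_mB, card_mC] at *; omega
  · have e1 : Finset.card ({6,7,13,11,12,0} : Finset (ZMod 18)) = 6 := by decide
    have e2 : Finset.card ({0,4,6,11,13,17} : Finset (ZMod 18)) = 6 := by decide
    have e3 : Finset.card ({6,17} : Finset (ZMod 18)) = 2 := by decide
    rw [e1, e2, e3]; omega

theorem Sys.L4 {q : ℂ} {N : ℕ} {F} (h : Sys q N F) (hN : 7 ≤ N) (x y : ℂ) (hx : x ≠ 0) (hy : y ≠ 0)
    (hxy : ‖x‖ ≠ ‖y‖) (s : Multiset ℂ)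
    (hs : Multiset.card (orb q x mT + orb q y mB + s) = N) :
    F (orb q x mT + orb q y mB + s) = 0 := by
  have hq := h.hq
  refine h.ext _ {0, ‖x‖, ‖y‖} ?_ s hs
  clear hs s
  intro s hs h1 h2
  simp only [Multiset.card_add, card_orb, card_mT, card_mB] at hs
  have hpos : 0 < Multiset.card s := by omega
  obtain ⟨z, hz⟩ := Multiset.card_pos_iff_exists_mem.1 hpos
  obtain ⟨s, rfl⟩ := Multiset.exists_cons_of_mem hz
  rw [Multiset.map_cons, Multiset.nodup_cons] at h1
  rw [Multiset.card_cons] at hs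
  have h2' : ∀ r ∈ s, r ≠ 0 ∧ ‖r‖ ≠ ‖x‖ ∧ ‖r‖ ≠ ‖y‖ := fun r hr => by
    have := h2 r (Multiset.mem_cons_of_mem hr); simpa using this
  obtain ⟨p, hp1, hp2⟩ := h.D1 (orb q x mT + orb q y mB + s) (by
    simp only [Multiset.card_add, card_orb, card_mT, card_mB]; omega)
  suffices hp : p = 0 by
    have := hp2 z
    rw [hp, Polynomial.eval_zero] at this
    rw [this, Multiset.add_cons]
  refine count2 hq p x y {6,7,13} {17,13} {5,13} s hx hy hxy h1.2 h2' ?_ ?_ ?_ ?_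
  · intro e he
    rw [hp2]
    refine h.Z0use hx (chk_rT e he) (orb q y mB + s) ?_ ?_
    · simp only [orb_add, orb_single, ← Multiset.singleton_add]; abel
    · simp only [Multiset.card_add, card_orb, card_mT, card_mB, Multiset.card_cons] at *; omega
  · intro e he
    rw [hp2]
    refine h.L6use hy hxy (chk_rB e he) s ?_ ?_
    · simp only [orb_add, orb_single, ← Multiset.singleton_add]; abel
    · simp only [Multiset.card_add, card_orb, card_mT, card_mB, Multiset.card_cons] at *; omega
  · intro r hr e he
    rw [hp2]
    obtain ⟨s', rfl⟩ := Multiset.exists_cons_of_mem hr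
    refine Zc.use (N := N) (t := orb q x mT + orb q y mB) (m := mC) (r := r) hq ?_ (chk_rC e he) s' ?_ ?_
    · intro f u hu
      exact h.L5 x y _ hx hy hxy u hu
    · simp only [orb_add, orb_single, rotW_zero, ← Multiset.singleton_add]; abel
    · simp only [Multiset.card_add, card_orb, card_mT, card_mB, Multiset.card_cons] at *; omega
  · have e1 : Finset.card ({6,7,13} : Finset (ZMod 18)) = 3 := by decide
    have e2 : Finset.card ({17,13} : Finset (ZMod 18)) = 2 := by decide
    have e3 : Finset.card ({5,13} : Finset (ZMod 18)) = 2 := by decide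
    rw [e1, e2, e3]; omega

theorem Sys.L3 {q : ℂ} {N : ℕ} {F} (h : Sys q N F) (hN : 7 ≤ N) (x : ℂ) (hx : x ≠ 0)
    (s : Multiset ℂ) (hs : Multiset.card (orb q x mT + s) = N) :
    F (orb q x mT + s) = 0 := by
  have hq := h.hq
  refine h.ext _ {0, ‖x‖} ?_ s hs
  clear hs s
  intro s hs h1 h2
  simp only [Multiset.card_add, card_orb, card_mT] at hs
  have hpos : 0 < Multiset.card s := by omega
  obtain ⟨z, hz⟩ := Multiset.card_pos_iff_exists_mem.1 hpos
  obtain ⟨s, rfl⟩ := Multiset.exists_cons_of_mem hz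
  rw [Multiset.map_cons, Multiset.nodup_cons] at h1
  rw [Multiset.card_cons] at hs
  have h2' : ∀ r ∈ s, r ≠ 0 ∧ ‖r‖ ≠ ‖x‖ := fun r hr => by
    have := h2 r (Multiset.mem_cons_of_mem hr); simpa using this
  obtain ⟨p, hp1, hp2⟩ := h.D1 (orb q x mT + s) (by
    simp only [Multiset.card_add, card_orb, card_mT]; omega)
  suffices hp : p = 0 by
    have := hp2 z
    rw [hp, Polynomial.eval_zero] at this
    rw [this, Multiset.add_cons]
  refine count1 hq p x {6,7,13} {6,12} s hx h1.2 h2' ?_ ?_ ?_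
  · intro e he
    rw [hp2]
    refine h.Z0use hx (chk_rT e he) s ?_ ?_
    · simp only [orb_add, orb_single, ← Multiset.singleton_add]; abel
    · simp only [Multiset.card_add, card_orb, card_mT, Multiset.card_cons] at *; omega
  · intro r hr e he
    rw [hp2]
    obtain ⟨s', rfl⟩ := Multiset.exists_cons_of_mem hr
    refine Zc.use (N := N) (t := orb q x mT) (m := mB) (r := r) hq ?_ (chk_rrB e he) s' ?_ ?_
    · intro f u hu
      refine h.L4 hN x _ hx (rotW_ne hq _ (h2' r hr).1) ?_ u hu
      rw [norm_rotW hq]; exact (h2' r hr).2.symm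
    · simp only [orb_add, orb_single, rotW_zero, ← Multiset.singleton_add]; abel
    · simp only [Multiset.card_add, card_orb, card_mT, Multiset.card_cons] at *; omega
  · have e1 : Finset.card ({6,7,13} : Finset (ZMod 18)) = 3 := by decide
    have e3 : Finset.card ({6,12} : Finset (ZMod 18)) = 2 := by decide
    rw [e1, e3]; omega

theorem Sys.L3' {q : ℂ} {N : ℕ} {F} (h : Sys q N F) (hN : 7 ≤ N) (x : ℂ) (hx : x ≠ 0)
    (s : Multiset ℂ) (hs : Multiset.card (orb q x mT' + s) = N) :
    F (orb q x mT' + s) = 0 := by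
  refine h.ext _ {‖x‖} ?_ s hs
  clear hs s
  intro s hs h1 h2
  simp only [Multiset.card_add, card_orb, card_mT'] at hs
  apply h.fusT' hx _ (by omega)
  · intro r hr
    simpa using h2 r hr
  · exact h.L3 hN x hx s (by simp only [Multiset.card_add, card_orb, card_mT]; omega)

theorem Sys.L3use {q : ℂ} {N : ℕ} {F} (h : Sys q N F) (hN : 7 ≤ N) {y : ℂ} (hy : y ≠ 0)
    {m' : Multiset (ZMod 18)} (hm : hasT m') (s : Multiset ℂ) {U : Multiset ℂ}
    (hU : U = orb q y m' + s) (hc : Multiset.card U = N) : F U = 0 := by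
  have hq := h.hq
  rcases hm with hm | hm
  · refine Zc.use (N := N) (t := 0) (m := mT) (r := y) hq ?_ hm s (by rw [zero_add, hU]) hc
    intro e s hs
    rw [zero_add] at hs ⊢
    exact h.L3 hN _ (rotW_ne hq _ hy) s hs
  · refine Zc.use (N := N) (t := 0) (m := mT') (r := y) hq ?_ hm s (by rw [zero_add, hU]) hc
    intro e s hs
    rw [zero_add] at hs ⊢
    exact h.L3' hN _ (rotW_ne hq _ hy) s hs

theorem Sys.L2 {q : ℂ} {N : ℕ} {F} (h : Sys q N F) (hN : 7 ≤ N) (y z : ℂ) (hy : y ≠ 0)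
    (s : Multiset ℂ)
    (hs : Multiset.card (orb q y mB + orb q z mC + s) = N) :
    F (orb q y mB + orb q z mC + s) = 0 := by
  have hq := h.hq
  refine h.ext _ {0, ‖y‖} ?_ s hs
  clear hs s
  intro s hs h1 h2
  have h2' : ∀ r ∈ s, r ≠ 0 ∧ ‖r‖ ≠ ‖y‖ := fun r hr => by
    have := h2 r hr; simpa using this
  simp only [Multiset.card_add, card_orb, card_mB, card_mC] at hs
  obtain ⟨p, hp1, hp2⟩ := h.D2o 0 13 (orb q y mB + s) (by
    simp only [Multiset.card_add, card_orb, card_mB]; omega)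
  change ∀ x, p.eval x = F (orb q x mC + _) at hp2
  suffices hp : p = 0 by
    have := hp2 z
    rw [hp, Polynomial.eval_zero] at this
    rw [this]; congr 1; abel
  refine count1 hq p y {0,4,6,11,13,17} {6,17} s hy h1 h2' ?_ ?_ ?_
  · intro e he
    rw [hp2]
    refine h.L3use hN hy (chk_BC e he) s ?_ ?_
    · simp only [orb_rot hq, orb_add]; abel
    · simp only [Multiset.card_add, card_orb, card_mB, card_mC] at *; omega
  · intro r hr e he
    rw [hp2]
    obtain ⟨s', rfl⟩ := Multiset.exists_cons_of_mem hr
    refine h.L3use hN (h2' r hr).1 (chk_Cr e he) (orb q y mB + s') ?_ ?_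
    · simp only [orb_rot hq, orb_add, orb_zero, ← Multiset.singleton_add]; abel
    · simp only [Multiset.card_add, card_orb, card_mB, card_mC] at *; omega
  · have e2 : Finset.card ({0,4,6,11,13,17} : Finset (ZMod 18)) = 6 := by decide
    have e3 : Finset.card ({6,17} : Finset (ZMod 18)) = 2 := by decide
    rw [e2, e3]; omega

theorem Sys.L1 {q : ℂ} {N : ℕ} {F} (h : Sys q N F) (hN : 7 ≤ N) (y : ℂ) (hy : y ≠ 0)
    (s : Multiset ℂ) (hs : Multiset.card (orb q y mB + s) = N) :
    F (orb q y mB + s) = 0 := by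
  have hq := h.hq
  refine h.ext _ {0, ‖y‖} ?_ s hs
  clear hs s
  intro s hs h1 h2
  simp only [Multiset.card_add, card_orb, card_mB] at hs
  have hpos : 0 < Multiset.card s := by omega
  obtain ⟨z, hz⟩ := Multiset.card_pos_iff_exists_mem.1 hpos
  obtain ⟨s, rfl⟩ := Multiset.exists_cons_of_mem hz
  rw [Multiset.map_cons, Multiset.nodup_cons] at h1
  rw [Multiset.card_cons] at hs
  have h2' : ∀ r ∈ s, r ≠ 0 ∧ ‖r‖ ≠ ‖y‖ := fun r hr => by
    have := h2 r (Multiset.mem_cons_of_mem hr); simpa using this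
  obtain ⟨p, hp1, hp2⟩ := h.D1 (orb q y mB + s) (by
    simp only [Multiset.card_add, card_orb, card_mB]; omega)
  suffices hp : p = 0 by
    have := hp2 z
    rw [hp, Polynomial.eval_zero] at this
    rw [this, Multiset.add_cons]
  refine count1 hq p y {17,13} {5,13} s hy h1.2 h2' ?_ ?_ ?_
  · intro e he
    rw [hp2]
    refine h.L3use hN hy (chk_rB e he) s ?_ ?_
    · simp only [orb_add, orb_single, ← Multiset.singleton_add]; abel
    · simp only [Multiset.card_add, card_orb, card_mB, Multiset.card_cons] at *; omega
  · intro r hr e he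
    rw [hp2]
    obtain ⟨s', rfl⟩ := Multiset.exists_cons_of_mem hr
    refine Zc.use (N := N) (t := orb q y mB) (m := mC) (r := r) hq ?_ (chk_rC e he) s' ?_ ?_
    · intro f u hu
      exact h.L2 hN y _ hy u hu
    · simp only [orb_add, orb_single, rotW_zero, ← Multiset.singleton_add]; abel
    · simp only [Multiset.card_add, card_orb, card_mB, Multiset.card_cons] at *; omega
  · have e2 : Finset.card ({17,13} : Finset (ZMod 18)) = 2 := by decide
    have e3 : Finset.card ({5,13} : Finset (ZMod 18)) = 2 := by decide
    rw [e2, e3]; omega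

theorem Sys.L0 {q : ℂ} {N : ℕ} {F} (h : Sys q N F) (hN : 7 ≤ N)
    (s : Multiset ℂ) (hs : Multiset.card s = N) : F s = 0 := by
  have hq := h.hq
  have := h.ext 0 {0} ?_ s (by simpa using hs)
  · simpa using this
  clear hs s
  intro s hs h1 h2
  rw [zero_add] at hs ⊢
  have hpos : 0 < Multiset.card s := by omega
  obtain ⟨z, hz⟩ := Multiset.card_pos_iff_exists_mem.1 hpos
  obtain ⟨s, rfl⟩ := Multiset.exists_cons_of_mem hz
  rw [Multiset.map_cons, Multiset.nodup_cons] at h1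
  rw [Multiset.card_cons] at hs
  have h2' : ∀ r ∈ s, r ≠ 0 := fun r hr => by
    have := h2 r (Multiset.mem_cons_of_mem hr); simpa using this
  obtain ⟨p, hp1, hp2⟩ := h.D1 s hs
  suffices hp : p = 0 by
    rw [← hp2 z, hp, Polynomial.eval_zero]
  refine count0 hq p {6,12} s h1.2 h2' ?_ ?_
  · intro r hr e he
    rw [hp2]
    obtain ⟨s', rfl⟩ := Multiset.exists_cons_of_mem hr
    refine Zc.use (N := N) (t := 0) (m := mB) (r := r) hq ?_ (chk_rrB e he) s' ?_ ?_
    · intro f u hu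
      rw [zero_add] at hu ⊢
      exact h.L1 hN _ (rotW_ne hq _ (h2' r hr)) u hu
    · simp only [orb_add, orb_single, rotW_zero, ← Multiset.singleton_add]; abel
    · rw [Multiset.card_cons]; exact hs
  · have e3 : Finset.card ({6,12} : Finset (ZMod 18)) = 2 := by decide
    rw [e3]; omega

/-- product of all pair sums -/
def pairProd {R : Type*} [CommRing R] (s : Multiset R) : R :=
  ((s.powersetCard 2).map Multiset.sum).prod

theorem pairProd_cons {R : Type*} [CommRing R] (a : R) (s : Multiset R) :
    pairProd (a ::ₘ s) = pairProd s * (s.map fun r => a + r).prod := by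
  unfold pairProd
  rw [Multiset.powersetCard_cons, Multiset.map_add, Multiset.prod_add, Multiset.map_map,
    Multiset.powersetCard_one, Multiset.map_map]
  congr 2
  apply Multiset.map_congr rfl
  intro r _
  simp

/-- product of all `X i + X j` -/
noncomputable def pairV (N : ℕ) : MvPolynomial (Fin N) ℂ :=
  ∏ t ∈ Finset.univ.powersetCard 2, ∑ i ∈ t, X i

theorem map_pairV {N : ℕ} {R : Type*} [CommRing R] (f : MvPolynomial (Fin N) ℂ →+* R) :
    f (pairV N) = pairProd (Finset.univ.val.map fun i => f (X i)) := by
  unfold pairV pairProd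
  rw [map_prod, Multiset.powersetCard_map, ← Finset.map_val_val_powersetCard, Multiset.map_map,
    Multiset.map_map, Finset.prod]
  congr 1
  apply Multiset.map_congr rfl
  intro t _
  show f (∑ i ∈ t, X i) = ((t.val.map fun i => f (X i))).sum
  rw [map_sum]
  rfl

theorem symm_pairV (N : ℕ) : (pairV N).IsSymmetric := by
  intro σ
  have h1 := map_pairV (rename σ : MvPolynomial (Fin N) ℂ →ₐ[ℂ] _).toRingHom
  have h2 := map_pairV (RingHom.id (MvPolynomial (Fin N) ℂ))
  have h1' : rename σ (pairV N) = _ := h1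
  have h2' : pairV N = _ := h2
  rw [h1', h2']
  congr 1
  have : (Finset.univ.val.map fun i => (RingHom.id (MvPolynomial (Fin N) ℂ)) (X i))
    = (Finset.univ.val.map σ).map (fun i : Fin N => (X i : MvPolynomial (Fin N) ℂ)) := by
    rw [Multiset.map_univ_val_equiv]; rfl
  rw [this, Multiset.map_map]
  apply Multiset.map_congr rfl
  intro i _
  simp

theorem dvd_of_vanish {N : ℕ} (K : MvPolynomial (Fin N) ℂ) (i j : Fin N) (hij : i ≠ j)
    (h : ∀ v : Fin N → ℂ, v i = - v j → eval v K = 0) : (X i + X j : MvPolynomial (Fin N) ℂ) ∣ K := by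
  classical
  rw [← Ideal.mem_span_singleton, ← Ideal.Quotient.eq_zero_iff_mem]
  set I := Ideal.span {(X i + X j : MvPolynomial (Fin N) ℂ)} with hI
  let g : Fin N → MvPolynomial (Fin N) ℂ := fun k => if k = i then - X j else X k
  have h0 : aeval g K = 0 := by
    apply MvPolynomial.funext
    intro v
    rw [map_zero]
    have : eval v (aeval g K) = eval (fun k => eval v (g k)) K := by
      rw [MvPolynomial.aeval_def, MvPolynomial.eval₂_eq_eval_map]
      have := MvPolynomial.eval₂_comp_left (eval v) (algebraMap ℂ (MvPolynomial (Fin N) ℂ)) g K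
      rw [← MvPolynomial.eval₂_eq_eval_map, this, MvPolynomial.eval_eq]
      rw [MvPolynomial.eval₂_eq]
      simp
    rw [this]
    apply h
    simp [g, hij.symm]
  have h1 : Ideal.Quotient.mk I (aeval g K) = Ideal.Quotient.mk I K := by
    have : ((Ideal.Quotient.mkₐ ℂ I).comp (aeval g)) = Ideal.Quotient.mkₐ ℂ I := by
      apply MvPolynomial.algHom_ext
      intro k
      simp only [AlgHom.comp_apply, aeval_X, Ideal.Quotient.mkₐ_eq_mk, g]
      split_ifs with hk
      · subst hk
        rw [Ideal.Quotient.eq, hI, Ideal.mem_span_singleton]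
        exact ⟨-1, by ring⟩
      · rfl
    exact DFunLike.congr_fun this K
  rw [← h1, h0, map_zero]

theorem pairSum_irred {N : ℕ} (i j : Fin N) (hij : i ≠ j) :
    Irreducible (X i + X j : MvPolynomial (Fin N) ℂ) := by
  have hc : coeff (Finsupp.single i 1) (X i + X j : MvPolynomial (Fin N) ℂ) = 1 := by
    rw [coeff_add, coeff_X, coeff_X, if_pos rfl, if_neg, add_zero]
    intro h
    exact hij ((Finsupp.single_left_injective one_ne_zero h).symm)
  apply irreducible_of_totalDegree_eq_one
  · apply le_antisymm
    · refine (totalDegree_add _ _).trans ?_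
      simp
    · have := le_totalDegree (p := (X i + X j : MvPolynomial (Fin N) ℂ)) (s := Finsupp.single i 1)
        (by rw [mem_support_iff, hc]; exact one_ne_zero)
      simpa using this
  · intro x hx
    have := hx (Finsupp.single i 1)
    rw [hc] at this
    exact isUnit_of_dvd_one this

theorem pairV_dvd {N : ℕ} (K : MvPolynomial (Fin N) ℂ)
    (h : ∀ i j : Fin N, i ≠ j → ∀ v : Fin N → ℂ, v i = - v j → eval v K = 0) : pairV N ∣ K := by
  classical
  unfold pairV
  apply Finset.prod_dvd_of_isRelPrime
  · intro t ht t' ht' hne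
    simp only [Finset.mem_coe, Finset.mem_powersetCard] at ht ht'
    have hex : ∃ k ∈ t', k ∉ t := by
      by_contra! hc
      exact hne (Finset.eq_of_subset_of_card_le hc (by omega)).symm
    obtain ⟨k, hk, hk'⟩ := hex
    obtain ⟨i, j, hij, rfl⟩ := Finset.card_eq_two.1 ht.2
    show IsRelPrime _ _
    rw [Irreducible.isRelPrime_iff_not_dvd]
    · rintro ⟨g, hg⟩
      have := congrArg (eval (fun l : Fin N => if l = k then (1:ℂ) else 0)) hg
      rw [map_mul, map_sum, map_sum] at this
      simp only [eval_X, Finset.sum_ite_eq', hk, hk', if_true, if_false, zero_mul] at this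
      exact one_ne_zero this
    · show Irreducible (∑ l ∈ ({i,j} : Finset (Fin N)), (X l : MvPolynomial (Fin N) ℂ))
      rw [Finset.sum_pair hij]; exact pairSum_irred i j hij
  · intro t ht
    obtain ⟨i, j, hij, rfl⟩ := Finset.card_eq_two.1 (Finset.mem_powersetCard.1 ht).2
    rw [Finset.sum_pair hij]
    exact dvd_of_vanish K i j hij (h i j hij)

theorem pairV_ne (N : ℕ) : pairV N ≠ 0 := by
  unfold pairV
  rw [Finset.prod_ne_zero_iff]
  intro t ht
  obtain ⟨i, j, hij, rfl⟩ := Finset.card_eq_two.1 (Finset.mem_powersetCard.1 ht).2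
  rw [Finset.sum_pair hij]
  exact (pairSum_irred i j hij).ne_zero

/-- scaling of the first `k` variables -/
noncomputable def scaleHom (N k : ℕ) :
    MvPolynomial (Fin N) ℂ →ₐ[ℂ] Polynomial (MvPolynomial (Fin N) ℂ) :=
  aeval fun i => if i.val < k then Polynomial.C (X i) * Polynomial.X else Polynomial.C (X i)

theorem scaleHom_natDegree {N k : ℕ} (K : MvPolynomial (Fin N) ℂ) :
    (scaleHom N k K).natDegree ≤ partialDeg k K := by
  classical
  rw [scaleHom, aeval_def, eval₂_eq]
  apply Polynomial.natDegree_sum_le_of_forall_le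
  intro m hm
  refine le_trans ?_ (Finset.le_sup (f := fun m : Fin N →₀ ℕ => ∑ i ∈ Finset.univ.filter (fun i : Fin N => i.val < k), m i) hm)
  have hC : (algebraMap ℂ (Polynomial (MvPolynomial (Fin N) ℂ))) (coeff m K)
      = Polynomial.C (MvPolynomial.C (coeff m K)) := rfl
  rw [hC]
  refine (Polynomial.natDegree_C_mul_le _ _).trans ?_
  refine (Polynomial.natDegree_prod_le _ _).trans ?_
  show _ ≤ ∑ i ∈ Finset.univ.filter (fun i : Fin N => i.val < k), m i
  rw [Finset.sum_filter]
  refine le_trans (Finset.sum_le_sum_of_subset (Finset.subset_univ _)) ?_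
  apply Finset.sum_le_sum
  intro i _
  refine Polynomial.natDegree_pow_le.trans ?_
  split_ifs with hi
  · have : (Polynomial.C (X i : MvPolynomial (Fin N) ℂ) * Polynomial.X).natDegree ≤ 1 :=
      (Polynomial.natDegree_C_mul_le _ _).trans Polynomial.natDegree_X_le
    nlinarith
  · simp

theorem scaleHom_eval {N k : ℕ} (K : MvPolynomial (Fin N) ℂ) (w : Fin N → ℂ) (x : ℂ) :
    ((scaleHom N k K).map (eval w)).eval x = eval (fun i => if i.val < k then w i * x else w i) K := by
  have : ((Polynomial.evalRingHom x).comp ((Polynomial.mapRingHom (eval w)).comp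
      (scaleHom N k).toRingHom)) = eval (fun i => if i.val < k then w i * x else w i) := by
    apply MvPolynomial.ringHom_ext
    · intro r
      simp [scaleHom, Polynomial.algebraMap_apply]
    · intro i
      simp only [scaleHom, RingHom.comp_apply, AlgHom.toRingHom_eq_coe, RingHom.coe_coe, aeval_X, eval_X]
      split_ifs <;> simp
  exact DFunLike.congr_fun this K

theorem scaleHom_eval_one {N k : ℕ} (K : MvPolynomial (Fin N) ℂ) :
    (scaleHom N k K).eval 1 = K := by
  have : ((Polynomial.evalRingHom 1).comp (scaleHom N k).toRingHom) = RingHom.id _ := by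
    apply MvPolynomial.ringHom_ext
    · intro r
      simp [scaleHom, Polynomial.algebraMap_apply]
    · intro i
      simp only [scaleHom, RingHom.comp_apply, AlgHom.toRingHom_eq_coe, RingHom.coe_coe, aeval_X]
      split_ifs <;> simp
  exact DFunLike.congr_fun this K

theorem pairProd_deg {R : Type*} [CommRing R] [IsDomain R] (a : Polynomial R)
    (s : Multiset (Polynomial R)) (h0 : pairProd (a ::ₘ s) ≠ 0)
    (h : ∀ r ∈ s, 1 ≤ (a + r).natDegree) :
    pairProd s ≠ 0 ∧ (pairProd s).natDegree + Multiset.card s ≤ (pairProd (a ::ₘ s)).natDegree := by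
  rw [pairProd_cons] at h0 ⊢
  have h1 := left_ne_zero_of_mul h0
  have h2 := right_ne_zero_of_mul h0
  refine ⟨h1, ?_⟩
  rw [Polynomial.natDegree_mul h1 h2, Polynomial.natDegree_multiset_prod, Multiset.map_map]
  · gcongr
    have := Multiset.card_nsmul_le_sum (s := s.map (Polynomial.natDegree ∘ fun r => a + r)) (a := 1) (by
      intro z hz
      obtain ⟨r, hr, rfl⟩ := Multiset.mem_map.1 hz
      exact h r hr)
    simpa using this
  · intro hz
    obtain ⟨r, hr, h3⟩ := Multiset.mem_map.1 hz
    have := h r hr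
    rw [h3] at this
    simp at this

theorem univ_map_succ {α : Type*} {n : ℕ} (g : Fin (n + 1) → α) :
    Finset.univ.val.map g = g 0 ::ₘ Finset.univ.val.map (fun i : Fin n => g i.succ) := by
  rw [Fin.univ_val_map, Fin.univ_val_map, List.ofFn_succ]
  rfl

theorem exists_fn {α : Type*} {n : ℕ} (s : Multiset α) (hs : Multiset.card s = n) :
    ∃ w : Fin n → α, Finset.univ.val.map w = s := by
  have key : ∀ l : List α, ∃ w : Fin l.length → α, Finset.univ.val.map w = (l : Multiset α) := by
    intro l
    refine ⟨l.get, ?_⟩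
    rw [Fin.univ_val_map]
    simp
  obtain ⟨w, hw⟩ := key s.toList
  have hl : s.toList.length = n := by rw [Multiset.length_toList, hs]
  rw [Multiset.coe_toList] at hw
  clear hs
  subst hl
  exact ⟨w, hw⟩

theorem scaleX_deg {N k : ℕ} (i j : Fin N) (hij : i ≠ j) (hi : i.val < k) :
    1 ≤ (scaleHom N k (X i) + scaleHom N k (X j)).natDegree := by
  apply Polynomial.le_natDegree_of_ne_zero
  simp only [scaleHom, aeval_X, hi, if_true]
  split_ifs with hj
  · simp
    exact (pairSum_irred i j hij).ne_zero
  · simp [Polynomial.coeff_C]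

theorem deg_pairV (M : ℕ) :
    M + 2 ≤ (scaleHom (M+3) 1 (pairV (M+3))).natDegree ∧
    2 * M + 3 ≤ (scaleHom (M+3) 2 (pairV (M+3))).natDegree ∧
    3 * M + 3 ≤ (scaleHom (M+3) 3 (pairV (M+3))).natDegree := by
  have hne : ∀ k, scaleHom (M+3) k (pairV (M+3)) ≠ 0 := by
    intro k h
    have := scaleHom_eval_one (k := k) (pairV (M+3))
    rw [h] at this
    exact pairV_ne _ (by rw [← this]; simp)
  have heq : ∀ k, scaleHom (M+3) k (pairV (M+3)) = _ := fun k => map_pairV (scaleHom (M+3) k).toRingHom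
  have s1 : ∀ k, 0 < k → _ := fun k hk =>
    pairProd_deg (scaleHom (M+3) k (X 0)) (Finset.univ.val.map fun i : Fin (M+2) => scaleHom (M+3) k (X i.succ))
    (by have := hne k; rw [heq, univ_map_succ] at this; exact this)
    (by
      intro r hr
      obtain ⟨j, -, rfl⟩ := Multiset.mem_map.1 hr
      exact scaleX_deg _ _ (Fin.succ_ne_zero j).symm hk)
  have s2 : ∀ k, 1 < k → _ := fun k hk =>
    pairProd_deg (scaleHom (M+3) k (X 1)) (Finset.univ.val.map fun i : Fin (M+1) => scaleHom (M+3) k (X i.succ.succ))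
    (by have := (s1 k (by omega)).1; rw [univ_map_succ] at this; exact this)
    (by
      intro r hr
      obtain ⟨j, -, rfl⟩ := Multiset.mem_map.1 hr
      refine scaleX_deg _ _ ?_ hk
      intro h
      have := congrArg Fin.val h
      simp at this)
  have s3 : ∀ k, 2 < k → _ := fun k hk =>
    pairProd_deg (scaleHom (M+3) k (X 2)) (Finset.univ.val.map fun i : Fin M => scaleHom (M+3) k (X i.succ.succ.succ))
    (by have := (s2 k (by omega)).1; rw [univ_map_succ] at this; exact this)
    (by
      intro r hr
      obtain ⟨j, -, rfl⟩ := Multiset.mem_map.1 hr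
      refine scaleX_deg _ _ ?_ hk
      intro h
      have := congrArg Fin.val h
      rw [Fin.val_succ, Fin.val_succ, Fin.val_succ] at this
      have h2 : (2 : Fin (M+3)).val = 2 := rfl
      omega)
  have t1 : ∀ k, 0 < k → _ := fun k hk => (s1 k hk).2
  have t2 : ∀ k, 1 < k → _ := fun k hk => (s2 k hk).2
  have t3 : ∀ k, 2 < k → _ := fun k hk => (s3 k hk).2
  simp only [Multiset.card_map, Finset.card_val, Finset.card_univ, Fintype.card_fin] at t1 t2 t3
  have a1 : ∀ k, 0 < k → (pairProd (Finset.univ.val.map fun i : Fin (M+2) => scaleHom (M+3) k (X i.succ))).natDegree + (M + 2) ≤ (scaleHom (M+3) k (pairV (M+3))).natDegree := by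
    intro k hk
    rw [heq, univ_map_succ (fun i : Fin (M+3) => (scaleHom (M+3) k).toRingHom (X i))]; exact t1 k hk
  have a2 : ∀ k, 1 < k → (pairProd (Finset.univ.val.map fun i : Fin (M+1) => scaleHom (M+3) k (X i.succ.succ))).natDegree + (M + 1) ≤ (pairProd (Finset.univ.val.map fun i : Fin (M+2) => scaleHom (M+3) k (X i.succ))).natDegree := by
    intro k hk
    rw [univ_map_succ (fun i : Fin (M+2) => scaleHom (M+3) k (X i.succ))]; exact t2 k hk
  have a3 : ∀ k, 2 < k → (pairProd (Finset.univ.val.map fun i : Fin M => scaleHom (M+3) k (X i.succ.succ.succ))).natDegree + M ≤ (pairProd (Finset.univ.val.map fun i : Fin (M+1) => scaleHom (M+3) k (X i.succ.succ))).natDegree := by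
    intro k hk
    rw [univ_map_succ (fun i : Fin (M+1) => scaleHom (M+3) k (X i.succ.succ))]; exact t3 k hk
  have b1 := a1 1 (by omega)
  have b2 := a1 2 (by omega)
  have b3 := a1 3 (by omega)
  have c2 := a2 2 (by omega)
  have c3 := a2 3 (by omega)
  have d3 := a3 3 (by omega)
  omega

theorem exists_multiset_fun {N : ℕ} (Q : MvPolynomial (Fin N) ℂ) (hQ : Q.IsSymmetric) :
    ∃ F : Multiset ℂ → ℂ, ∀ v, eval v Q = F (Finset.univ.val.map v) := by
  obtain ⟨G, hG⟩ := esymmAlgHom_surjective (σ := Fin N) (n := N) ℂ (by simp) ⟨Q, hQ⟩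
  have hG' := congrArg Subtype.val hG
  rw [esymmAlgHom_apply] at hG'
  refine ⟨fun s => aeval (fun i : Fin N => s.esymm (i + 1)) G, ?_⟩
  intro v
  have h : Q = aeval (fun i : Fin N => esymm (Fin N) ℂ (i + 1)) G := hG'.symm
  rw [h]
  have h2 : eval v (aeval (fun i : Fin N => esymm (Fin N) ℂ (i + 1)) G)
      = ((aeval v).comp (aeval (fun i : Fin N => esymm (Fin N) ℂ (i + 1)))) G := by
    rw [AlgHom.comp_apply, ← MvPolynomial.coe_aeval_eq_eval]
    rfl
  rw [h2]
  congr 1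
  apply MvPolynomial.algHom_ext
  intro i
  rw [AlgHom.comp_apply, aeval_X, aeval_X, aeval_esymm_eq_multiset_esymm]

theorem kin_all {M : ℕ} (K : MvPolynomial (Fin (M+3)) ℂ) (hsym : K.IsSymmetric)
    (hkin : ∀ (x : ℂ) (v : Fin (M+3) → ℂ),
      eval (fun i : Fin (M+3) => if i.val = 0 then -x else if i.val = 1 then x else v i) K = 0)
    (i j : Fin (M+3)) (hij : i ≠ j) (v : Fin (M+3) → ℂ) (hv : v i = - v j) : eval v K = 0 := by
  have hσ : ∃ σ : Equiv.Perm (Fin (M+3)), σ 0 = i ∧ σ 1 = j := by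
    let τ := Equiv.swap (0 : Fin (M+3)) i
    refine ⟨(Equiv.swap 1 (τ j)).trans τ, ?_, ?_⟩
    · rw [Equiv.trans_apply, Equiv.swap_apply_of_ne_of_ne (a := 1) (b := τ j)]
      · exact Equiv.swap_apply_left _ _
      · intro h; exact absurd (congrArg Fin.val h) (by simp)
      · intro h
        have : τ 0 = τ (τ j) := congrArg τ h
        have e1 : τ 0 = i := Equiv.swap_apply_left _ _
        have e2 : τ (τ j) = j := Equiv.swap_apply_self _ _ _
        rw [e1, e2] at this
        exact hij this
    · rw [Equiv.trans_apply, Equiv.swap_apply_left (1 : Fin (M+3)) (τ j)]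
      exact Equiv.swap_apply_self _ _ _
  obtain ⟨σ, h0, h1⟩ := hσ
  rw [← hsym σ, eval_rename]
  have := hkin (v j) (v ∘ σ)
  convert this using 2
  congr 1
  funext k
  split_ifs with a b
  · have : k = 0 := Fin.ext a
    subst this
    simp [h0, hv]
  · have : k = 1 := Fin.ext b
    subst this
    simp [h1]
  · rfl

theorem rot_add {q : ℂ} (hq : IsPrimitiveRoot q 18) (e : ZMod 18) (x r : ℂ) :
    rotW q e x + r = q ^ e.val * (x - rotW q (9 - e) r) := by
  have h9 : q ^ 9 = -1 := by
    have h : (q ^ 9 - 1) * (q ^ 9 + 1) = 0 := by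
      have := hq.pow_eq_one
      linear_combination this
    rcases mul_eq_zero.1 h with h | h
    · exact absurd (sub_eq_zero.1 h) (hq.pow_ne_one_of_pos_of_lt (by norm_num) (by norm_num))
    · linear_combination h
  have h1 : q ^ e.val * rotW q (9 - e) r = rotW q e (rotW q (9 - e) r) := rfl
  rw [mul_sub, h1, rotW_rotW hq]
  have h2 : e + (9 - e) = 9 := by ring
  have h3 : rotW q 9 r = - r := by
    have : (9 : ZMod 18).val = 9 := rfl
    rw [rotW, this, h9]; ring
  rw [h2, h3, rotW]; ring

/-- product of `x - W_e r` -/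
noncomputable def rotP (q : ℂ) (e : ZMod 18) (x : ℂ) (s : Multiset ℂ) : ℂ :=
  (s.map fun r => x - rotW q e r).prod

theorem rotP_add {q : ℂ} (hq : IsPrimitiveRoot q 18) (e : ZMod 18) (x : ℂ) (s : Multiset ℂ) :
    (s.map fun r => rotW q e x + r).prod = (q ^ e.val) ^ (Multiset.card s) * rotP q (9 - e) x s := by
  simp_rw [rot_add hq]
  rw [Multiset.prod_map_mul, Multiset.map_const', Multiset.prod_replicate]
  rfl

theorem rotP_ne {q : ℂ} (hq : IsPrimitiveRoot q 18) (e : ZMod 18) (x : ℂ) (s : Multiset ℂ)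
    (h : ∀ r ∈ s, ‖r‖ ≠ ‖x‖) : rotP q e x s ≠ 0 := by
  apply Multiset.prod_ne_zero
  intro hz
  obtain ⟨r, hr, h0⟩ := Multiset.mem_map.1 hz
  exact sub_rot_ne hq _ (h r hr) h0

theorem pairProd_ne (s : Multiset ℂ) (h : (s.map norm).Nodup) : pairProd s ≠ 0 := by
  induction s using Multiset.induction_on with
  | empty => simp [pairProd]
  | cons a s ih =>
    rw [Multiset.map_cons, Multiset.nodup_cons] at h
    rw [pairProd_cons]
    refine mul_ne_zero (ih h.2) ?_
    apply Multiset.prod_ne_zero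
    intro hz
    obtain ⟨r, hr, h0⟩ := Multiset.mem_map.1 hz
    apply h.1
    rw [Multiset.mem_map]
    refine ⟨r, hr, ?_⟩
    rw [eq_neg_of_add_eq_zero_left h0, norm_neg]

theorem pairProd_three {q : ℂ} (hq : IsPrimitiveRoot q 18) (a b c : ZMod 18) (x : ℂ)
    (s : Multiset ℂ) : pairProd (rotW q a x ::ₘ rotW q b x ::ₘ rotW q c x ::ₘ s)
    = (((q ^ a.val * q ^ b.val * q ^ c.val) ^ (Multiset.card s) *
      ((q ^ a.val + q ^ b.val) * (q ^ a.val + q ^ c.val) * (q ^ b.val + q ^ c.val))) *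
      (x ^ 3 * pairProd s)) * (rotP q (9 - a) x s * rotP q (9 - b) x s * rotP q (9 - c) x s) := by
  rw [pairProd_cons, pairProd_cons, pairProd_cons]
  simp only [Multiset.map_cons, Multiset.prod_cons]
  rw [rotP_add hq, rotP_add hq, rotP_add hq, mul_pow, mul_pow]
  unfold rotW
  ring

theorem qsum_ne {q : ℂ} (hq : IsPrimitiveRoot q 18) (a b : ZMod 18) (h : 0 ≠ 9 - a + b) :
    q ^ a.val + q ^ b.val ≠ 0 := by
  have h1 := rot_add hq a 1 (rotW q b 1)
  rw [rotW_rotW hq] at h1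
  have h2 : q ^ a.val + q ^ b.val = rotW q a 1 + rotW q b 1 := by simp [rotW]
  rw [h2, h1]
  exact mul_ne_zero (pow_ne_zero _ (hq.ne_zero (by norm_num))) (sub_rot_self_ne' hq one_ne_zero _ h)

/-- the constant factor -/
noncomputable def kap (q : ℂ) (a b c : ZMod 18) (n : ℕ) : ℂ :=
  ((q ^ a.val * q ^ b.val * q ^ c.val) ^ n *
      ((q ^ a.val + q ^ b.val) * (q ^ a.val + q ^ c.val) * (q ^ b.val + q ^ c.val)))

theorem kappa_ne {q : ℂ} (hq : IsPrimitiveRoot q 18) (a b c : ZMod 18) (n : ℕ)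
    (h1 : 0 ≠ 9 - a + b) (h2 : 0 ≠ 9 - a + c) (h3 : 0 ≠ 9 - b + c) :
    kap q a b c n ≠ 0 := by
  unfold kap
  have hq0 : q ≠ 0 := hq.ne_zero (by norm_num)
  have := qsum_ne hq a b h1
  have := qsum_ne hq a c h2
  have := qsum_ne hq b c h3
  positivity

theorem rotP3 (q : ℂ) (a b c : ZMod 18) (x : ℂ) (s : Multiset ℂ) :
    (s.map fun r => (x - rotW q a r) * (x - rotW q b r) * (x - rotW q c r)).prod
    = rotP q a x s * rotP q b x s * rotP q c x s := by
  rw [Multiset.prod_map_mul, Multiset.prod_map_mul]; rfl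

theorem rotP3_poly (q : ℂ) (a b c : ZMod 18) (x : ℂ) (s : Multiset ℂ) :
    ∃ p : Polynomial ℂ, ∀ y, p.eval y =
      ((y ::ₘ s).map fun r => (x - rotW q a r) * (x - rotW q b r) * (x - rotW q c r)).prod := by
  refine ⟨(Polynomial.C x - Polynomial.C (q ^ a.val) * Polynomial.X) *
    (Polynomial.C x - Polynomial.C (q ^ b.val) * Polynomial.X) *
    (Polynomial.C x - Polynomial.C (q ^ c.val) * Polynomial.X) *
    Polynomial.C (s.map fun r => (x - rotW q a r) * (x - rotW q b r) * (x - rotW q c r)).prod, ?_⟩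
  intro y
  rw [Multiset.map_cons, Multiset.prod_cons]
  simp [rotW]

theorem fus_of {q : ℂ} (hq : IsPrimitiveRoot q 18) (M : ℕ) (F : Multiset ℂ → ℂ)
    (D1 : ∀ s, Multiset.card s + 1 = M + 3 → ∃ p : Polynomial ℂ, ∀ x, p.eval x = F (x ::ₘ s))
    (c c' : ℂ) (hc : c ≠ 0) (hc' : c' ≠ 0)
    (hf : ∀ x s, Multiset.card s = M →
      c * (rotP q 6 x s * rotP q 10 x s) *
        (pairProd (rotW q 2 x ::ₘ rotW q 1 x ::ₘ rotW q 14 x ::ₘ s) *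
        F (rotW q 2 x ::ₘ rotW q 1 x ::ₘ rotW q 14 x ::ₘ s)) =
      c' * (rotP q 12 x s * rotP q 8 x s) *
        (pairProd (rotW q 4 x ::ₘ rotW q 17 x ::ₘ rotW q 16 x ::ₘ s) *
        F (rotW q 4 x ::ₘ rotW q 17 x ::ₘ rotW q 16 x ::ₘ s))) :
    ∃ c c' : ℂ, c ≠ 0 ∧ c' ≠ 0 ∧ ∀ x, x ≠ 0 → ∀ s, Multiset.card s + 3 = M + 3 →
    c * (s.map fun r => (x - rotW q 6 r) * (x - rotW q 7 r) * (x - rotW q 13 r)).prod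
      * F (orb q x mT + s) =
    c' * (s.map fun r => (x - rotW q 12 r) * (x - rotW q 11 r) * (x - rotW q 5 r)).prod
      * F (orb q x mT' + s) := by
  have hT : ∀ x s, orb q x mT + s = rotW q 2 x ::ₘ rotW q 1 x ::ₘ rotW q 14 x ::ₘ s := by
    intro x s; simp [orb, mT]
  have hT' : ∀ x s, orb q x mT' + s = rotW q 4 x ::ₘ rotW q 17 x ::ₘ rotW q 16 x ::ₘ s := by
    intro x s; simp [orb, mT']
  refine ⟨c * kap q 2 1 14 M, c' * kap q 4 17 16 M, mul_ne_zero hc (kappa_ne hq 2 1 14 M (by decide) (by decide) (by decide)),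
    mul_ne_zero hc' (kappa_ne hq 4 17 16 M (by decide) (by decide) (by decide)), ?_⟩
  intro x hx s hs
  rw [← sub_eq_zero]
  revert s
  suffices h : ∀ s, Multiset.card s = M → _ = (0:ℂ) from fun s hs => h s (by omega)
  refine gen_ext _ M ?_ {0, ‖x‖} ?_
  · intro s hs
    obtain ⟨p1, hp1⟩ := rotP3_poly q 6 7 13 x s
    obtain ⟨p2, hp2⟩ := rotP3_poly q 12 11 5 x s
    obtain ⟨p3, hp3⟩ := D1 (orb q x mT + s) (by rw [Multiset.card_add, card_orb]; simp [mT]; omega)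
    obtain ⟨p4, hp4⟩ := D1 (orb q x mT' + s) (by rw [Multiset.card_add, card_orb]; simp [mT']; omega)
    refine ⟨Polynomial.C (c * kap q 2 1 14 M) * p1 * p3 - Polynomial.C (c' * kap q 4 17 16 M) * p2 * p4, ?_⟩
    intro y
    rw [Polynomial.eval_sub, Polynomial.eval_mul, Polynomial.eval_mul, Polynomial.eval_mul,
      Polynomial.eval_mul, hp1, hp2, hp3, hp4, Polynomial.eval_C, Polynomial.eval_C,
      Multiset.add_cons, Multiset.add_cons]
  · intro s hs h1 h2
    have h3 : ∀ r ∈ s, ‖r‖ ≠ ‖x‖ := by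
      intro r hr h
      exact h2 r hr (by simp [h])
    have hnz : x ^ 3 * pairProd s * (rotP q 8 x s * rotP q 10 x s) ≠ 0 :=
      mul_ne_zero (mul_ne_zero (pow_ne_zero _ hx) (pairProd_ne s h1))
        (mul_ne_zero (rotP_ne hq _ _ _ h3) (rotP_ne hq _ _ _ h3))
    have := hf x s hs
    rw [pairProd_three hq, pairProd_three hq, hs] at this
    have e1 : (9 : ZMod 18) - 2 = 7 := rfl
    have e2 : (9 : ZMod 18) - 1 = 8 := rfl
    have e3 : (9 : ZMod 18) - 14 = 13 := rfl
    have e4 : (9 : ZMod 18) - 4 = 5 := rfl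
    have e5 : (9 : ZMod 18) - 17 = 10 := rfl
    have e6 : (9 : ZMod 18) - 16 = 11 := rfl
    rw [e1, e2, e3, e4, e5, e6] at this
    rw [rotP3, rotP3, hT, hT']
    apply mul_left_cancel₀ hnz
    rw [mul_zero]
    unfold kap
    linear_combination this

theorem Q_poly {M k : ℕ} {K Q : MvPolynomial (Fin (M+3)) ℂ} (hKQ : K = pairV (M+3) * Q) (hQ : Q ≠ 0)
    (w : Fin (M+3) → ℂ) {A B : ℕ} (hA : partialDeg k K ≤ A)
    (hB : B ≤ (scaleHom (M+3) k (pairV (M+3))).natDegree) :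
    ∃ p : Polynomial ℂ, p.natDegree + B ≤ A ∧
      ∀ x, p.eval x = eval (fun i => if i.val < k then w i * x else w i) Q := by
  refine ⟨(scaleHom (M+3) k Q).map (eval w), ?_, fun x => scaleHom_eval Q w x⟩
  have hne : ∀ P : MvPolynomial (Fin (M+3)) ℂ, P ≠ 0 → scaleHom (M+3) k P ≠ 0 := by
    intro P hP h
    have := scaleHom_eval_one (k := k) P
    rw [h] at this
    exact hP (by rw [← this]; simp)
  have h1 := scaleHom_natDegree (k := k) K
  rw [hKQ, map_mul, Polynomial.natDegree_mul (hne _ (pairV_ne _)) (hne _ hQ), ← hKQ] at h1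
  have h2 : ((scaleHom (M+3) k Q).map (eval w)).natDegree ≤ (scaleHom (M+3) k Q).natDegree :=
    Polynomial.natDegree_map_le
  omega

theorem exp_q (n : ℕ) (z : ℂ) (m : ℤ)
    (h : z = n * (2 * Real.pi * Complex.I / 18) + m * (2 * Real.pi * Complex.I)) :
    Complex.exp z = Complex.exp (2 * Real.pi * Complex.I / 18) ^ n := by
  rw [← Complex.exp_nat_mul, Complex.exp_eq_exp_iff_exists_int]
  exact ⟨m, h⟩

/-- completeness theorem for the A₁ tower of the E₇ model.  A symmetric
homogeneous polynomial with partial degrees `deg_k ≤ k(2N−k−1)` satisfying both the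
kinematic kernel condition and the three-A₁ fusion equation vanishes (N ≥ 7). -/
theorem A1_tower_completeness (N : ℕ) (hN : 7 ≤ N)
    (K : MvPolynomial (Fin N) ℂ) (hsym : K.IsSymmetric)
    (d : ℕ) (hhom : K.IsHomogeneous d)
    (hdeg : ∀ k : ℕ, 1 ≤ k → k ≤ N → partialDeg k K ≤ k * (2 * N - k - 1))
    (hkin : ∀ (x : ℂ) (v : Fin N → ℂ),
      eval (fun i : Fin N => if i.val = 0 then -x else if i.val = 1 then x else v i) K = 0)
    (hfus : ∀ (x : ℂ) (v : Fin N → ℂ),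
      Complex.exp (2 * Real.pi * Complex.I * ((N : ℂ) - 2) / 9) *
        (∏ i ∈ Finset.univ.filter (fun i : Fin N => 3 ≤ i.val),
          ((x - Complex.exp (12 * Real.pi * Complex.I / 18) * v i) *
           (x - Complex.exp (-(16 * Real.pi * Complex.I) / 18) * v i))) *
        eval (fun i : Fin N =>
          if i.val = 0 then Complex.exp (4 * Real.pi * Complex.I / 18) * x
          else if i.val = 1 then Complex.exp (2 * Real.pi * Complex.I / 18) * x
          else if i.val = 2 then Complex.exp (-(8 * Real.pi * Complex.I) / 18) * x
          else v i) K
      =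
      Complex.exp (-(2 * Real.pi * Complex.I * ((N : ℂ) - 2)) / 9) *
        (∏ i ∈ Finset.univ.filter (fun i : Fin N => 3 ≤ i.val),
          ((x - Complex.exp (-(12 * Real.pi * Complex.I) / 18) * v i) *
           (x - Complex.exp (16 * Real.pi * Complex.I / 18) * v i))) *
        eval (fun i : Fin N =>
          if i.val = 0 then Complex.exp (8 * Real.pi * Complex.I / 18) * x
          else if i.val = 1 then Complex.exp (-(2 * Real.pi * Complex.I) / 18) * x
          else if i.val = 2 then Complex.exp (-(4 * Real.pi * Complex.I) / 18) * x
          else v i) K) :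
    K = 0 := by
  obtain ⟨M, rfl⟩ : ∃ M, N = M + 3 := ⟨N - 3, by omega⟩
  obtain ⟨Q, hKQ⟩ := pairV_dvd K (kin_all K hsym hkin)
  by_cases hQ0 : Q = 0
  · rw [hKQ, hQ0, mul_zero]
  have hQs : Q.IsSymmetric := by
    intro σ
    have h := hsym σ
    rw [hKQ, map_mul, symm_pairV _ σ] at h
    exact mul_left_cancel₀ (pairV_ne _) h
  obtain ⟨F, hF⟩ := exists_multiset_fun Q hQs
  have hK : ∀ v, eval v K = pairProd (Finset.univ.val.map v) * F (Finset.univ.val.map v) := by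
    intro v
    rw [hKQ, map_mul, hF, map_pairV]
    simp only [eval_X]
  obtain ⟨v1, v2, v3⟩ := deg_pairV M
  have d1 := hdeg 1 (by omega) (by omega)
  have d2 := hdeg 2 (by omega) (by omega)
  have d3 := hdeg 3 (by omega) (by omega)
  set q := Complex.exp (2 * Real.pi * Complex.I / 18) with hqdef
  have hq : IsPrimitiveRoot q 18 := by
    have := Complex.isPrimitiveRoot_exp 18 (by norm_num)
    have h18 : ((18 : ℕ) : ℂ) = 18 := by norm_num
    rw [h18] at this
    exact this
  have h22 : 2 % (M + 3) = 2 := Nat.mod_eq_of_lt (by omega)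
  have D1 : ∀ s, Multiset.card s + 1 = M + 3 → ∃ p : Polynomial ℂ, p.natDegree + 1 ≤ M + 3 ∧
      ∀ x, p.eval x = F (x ::ₘ s) := by
    intro s hs
    obtain ⟨w, rfl⟩ := exists_fn (n := M + 2) s (by omega)
    obtain ⟨p, hp, hp'⟩ := Q_poly hKQ hQ0 (Fin.cons 1 w) d1 v1
    refine ⟨p, by omega, fun x => ?_⟩
    rw [hp', hF, univ_map_succ]
    simp
  have D2 : ∀ a b s, Multiset.card s + 2 = M + 3 → ∃ p : Polynomial ℂ, p.natDegree + 3 ≤ 2 * (M + 3) ∧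
      ∀ x, p.eval x = F (a * x ::ₘ b * x ::ₘ s) := by
    intro a b s hs
    obtain ⟨w, rfl⟩ := exists_fn (n := M + 1) s (by omega)
    obtain ⟨p, hp, hp'⟩ := Q_poly hKQ hQ0 (Fin.cons a (Fin.cons b w : Fin (M+2) → ℂ)) d2 v2
    refine ⟨p, by omega, fun x => ?_⟩
    rw [hp', hF, univ_map_succ, univ_map_succ]
    simp
  have D3 : ∀ a b c s, Multiset.card s + 3 = M + 3 → ∃ p : Polynomial ℂ, p.natDegree + 6 ≤ 3 * (M + 3) ∧
      ∀ x, p.eval x = F (a * x ::ₘ b * x ::ₘ c * x ::ₘ s) := by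
    intro a b c s hs
    obtain ⟨w, rfl⟩ := exists_fn (n := M) s (by omega)
    obtain ⟨p, hp, hp'⟩ := Q_poly hKQ hQ0
      (Fin.cons a (Fin.cons b (Fin.cons c w : Fin (M+1) → ℂ) : Fin (M+2) → ℂ)) d3 v3
    refine ⟨p, by omega, fun x => ?_⟩
    rw [hp', hF, univ_map_succ, univ_map_succ, univ_map_succ]
    have hc2 : (Fin.cons a (Fin.cons b (Fin.cons c w : Fin (M+1) → ℂ) : Fin (M+2) → ℂ) : Fin (M+3) → ℂ) 2 = c := rfl
    have hlt : ∀ n : ℕ, ¬ (n + 1 + 1 + 1 < 3) := fun n => by omega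
    simp [h22, hc2, hlt]
  have hmap : ∀ (a b c : ℂ) (v : Fin (M+3) → ℂ), (Finset.univ.val.map fun i : Fin (M+3) =>
      if i.val = 0 then a else if i.val = 1 then b else if i.val = 2 then c else v i) =
      a ::ₘ b ::ₘ c ::ₘ Finset.univ.val.map (fun i : Fin M => v i.succ.succ.succ) := by
    intro a b c v
    rw [univ_map_succ, univ_map_succ, univ_map_succ]
    simp [h22]
  have hprod : ∀ g : Fin (M+3) → ℂ, (∏ i ∈ Finset.univ.filter (fun i : Fin (M+3) => 3 ≤ i.val), g i)
      = ∏ i : Fin M, g i.succ.succ.succ := by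
    intro g
    rw [Finset.prod_filter, Fin.prod_univ_succ, Fin.prod_univ_succ, Fin.prod_univ_succ]
    simp [h22]
  have hsys : Sys q (M+3) F := by
    refine ⟨hq, D1, D2, D3, ?_⟩
    refine fus_of hq M F (fun s hs => ?_) _ _ (Complex.exp_ne_zero (2 * Real.pi * Complex.I * (((M + 3 : ℕ) : ℂ) - 2) / 9))
      (Complex.exp_ne_zero (-(2 * Real.pi * Complex.I * (((M + 3 : ℕ) : ℂ) - 2)) / 9)) ?_
    · obtain ⟨p, -, hp⟩ := D1 s hs
      exact ⟨p, hp⟩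
    intro x s hs
    obtain ⟨w, rfl⟩ := exists_fn s hs
    have := hfus x (Fin.cons 0 (Fin.cons 0 (Fin.cons 0 w : Fin (M+1) → ℂ) : Fin (M+2) → ℂ))
    rw [hprod, hprod, hK, hK, hmap, hmap] at this
    simp only [Fin.cons_succ] at this
    rw [exp_q 6 (12 * Real.pi * Complex.I / 18) 0 (by push_cast; ring),
      exp_q 10 (-(16 * Real.pi * Complex.I) / 18) (-1) (by push_cast; ring),
      exp_q 2 (4 * Real.pi * Complex.I / 18) 0 (by push_cast; ring),
      exp_q 14 (-(8 * Real.pi * Complex.I) / 18) (-1) (by push_cast; ring),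
      exp_q 12 (-(12 * Real.pi * Complex.I) / 18) (-1) (by push_cast; ring),
      exp_q 8 (16 * Real.pi * Complex.I / 18) 0 (by push_cast; ring),
      exp_q 4 (8 * Real.pi * Complex.I / 18) 0 (by push_cast; ring),
      exp_q 17 (-(2 * Real.pi * Complex.I) / 18) (-1) (by push_cast; ring),
      exp_q 16 (-(4 * Real.pi * Complex.I) / 18) (-1) (by push_cast; ring), ← hqdef] at this
    have hP : ∀ e : ZMod 18, rotP q e x (Finset.univ.val.map w) = ∏ i : Fin M, (x - q ^ e.val * w i) := by
      intro e
      rw [rotP, Multiset.map_map]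
      rfl
    rw [hP, hP, hP, hP, ← Finset.prod_mul_distrib, ← Finset.prod_mul_distrib]
    have h1 : rotW q 1 x = q * x := by
      have : (1 : ZMod 18).val = 1 := rfl
      rw [rotW, this, pow_one]
    rw [h1]
    exact this
  have : Q = 0 := by
    apply MvPolynomial.funext
    intro v
    rw [hF, map_zero]
    exact hsys.L0 hN _ (by simp)
  exact absurd this hQ0
end

section
/- For every α ∈ (0,1) and every real θ, the S-matrix building block admits the integral representation tanh(½(θ + iπα))/tanh(½(θ − iπα)) = −exp( −2i ∫₀^∞ [cosh((α − ½)t) / (t · cosh(t/2))] · sin(θt/π) dt ), where the integral is an absolutely convergent Lebesgue integral over (0,∞). -/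
open MeasureTheory

lemma bb_exp_cpow (u : ℝ) (z : ℂ) : ((Real.exp u : ℝ) : ℂ) ^ z = Complex.exp (u * z) := by
  rw [Complex.cpow_def_of_ne_zero (by exact_mod_cast (Real.exp_pos u).ne'),
    ← Complex.ofReal_log (Real.exp_pos u).le, Real.log_exp]

/-- the integrand on the whole line -/
noncomputable def bbG (s : ℂ) (t : ℝ) : ℂ := Complex.exp (s * t) / (1 + Complex.exp t)

lemma bb_point (s : ℂ) (t : ℝ) :
    |Real.sigmoid t * (1 - Real.sigmoid t)| •
      (((Real.sigmoid t : ℝ) : ℂ) ^ (s - 1) * (1 - ((Real.sigmoid t : ℝ) : ℂ)) ^ ((1 - s) - 1))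
      = bbG s t := by
  have hx := Real.sigmoid_pos t
  have hy : 0 < 1 - Real.sigmoid t := by linarith [Real.sigmoid_lt_one t]
  obtain ⟨L, hL⟩ : ∃ L, 1 - Real.sigmoid t = Real.exp L := ⟨_, (Real.exp_log hy).symm⟩
  have h1 : Real.sigmoid t = Real.exp (t + L) := by
    rw [Real.exp_add, ← hL, Real.sigmoid_def, Real.exp_neg]
    have := Real.exp_pos t
    field_simp
    ring
  have h2 : Real.exp L * (1 + Real.exp t) = 1 := by
    rw [Real.exp_add] at h1
    linarith
  have h2c : Complex.exp L * (1 + Complex.exp t) = 1 := by exact_mod_cast h2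
  have hne : (1 + Complex.exp t) ≠ 0 := by
    intro h; rw [h] at h2c; simp at h2c
  rw [abs_of_pos (mul_pos hx hy)]
  have hc : (1 - ((Real.sigmoid t : ℝ) : ℂ)) = ((Real.exp L : ℝ) : ℂ) := by
    rw [← hL]; push_cast; ring
  rw [hc, hL, h1, bb_exp_cpow, bb_exp_cpow, Complex.real_smul, bbG, eq_div_iff hne]
  push_cast
  rw [← Complex.exp_add, ← Complex.exp_add, ← Complex.exp_add]
  calc _ = Complex.exp (s * t) * (Complex.exp L * (1 + Complex.exp t)) := by
        rw [← mul_assoc, ← Complex.exp_add]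
        congr 2
        ring
    _ = _ := by rw [h2c, mul_one]

lemma bb_line (s : ℂ) (h0 : 0 < s.re) (h1 : s.re < 1) :
    Integrable (bbG s) ∧ ∫ t, bbG s t = Real.pi / Complex.sin (Real.pi * s) := by
  have h1' : 0 < (1 - s).re := by simp; linarith
  have hd : ∀ x ∈ (Set.univ : Set ℝ), HasDerivWithinAt Real.sigmoid
      (Real.sigmoid x * (1 - Real.sigmoid x)) Set.univ x :=
    fun x _ => (Real.hasDerivAt_sigmoid x).hasDerivWithinAt
  have hi : Set.InjOn Real.sigmoid Set.univ := Real.sigmoid_injective.injOn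
  have him : Real.sigmoid '' Set.univ = Set.Ioo 0 1 := by
    rw [Set.image_univ, Real.range_sigmoid]
  have hconv := Complex.betaIntegral_convergent h0 h1'
  rw [intervalIntegrable_iff_integrableOn_Ioo_of_le zero_le_one, ← him,
    integrableOn_image_iff_integrableOn_abs_deriv_smul MeasurableSet.univ hd hi] at hconv
  have hint := Complex.Gamma_mul_Gamma_eq_betaIntegral h0 h1'
  rw [Complex.Gamma_mul_Gamma_one_sub, add_sub_cancel, Complex.Gamma_one, one_mul,
    Complex.betaIntegral, intervalIntegral.integral_of_le zero_le_one,
    integral_Ioc_eq_integral_Ioo, ← him,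
    integral_image_eq_integral_abs_deriv_smul MeasurableSet.univ hd hi] at hint
  simp only [bb_point] at hconv hint
  rw [integrableOn_univ] at hconv
  rw [Measure.restrict_univ] at hint
  exact ⟨hconv, hint.symm⟩

lemma bb_cosh (s : ℂ) (t : ℝ) : bbG s t + bbG s (-t) =
    Complex.cosh ((s - 1 / 2) * t) / Complex.cosh (t / 2) := by
  have e1 : Complex.exp t = Complex.exp (t / 2) * Complex.exp (t / 2) := by
    rw [← Complex.exp_add]; ring_nf
  have e2 : Complex.exp (s * t) = Complex.exp ((s - 1 / 2) * t) * Complex.exp (t / 2) := by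
    rw [← Complex.exp_add]; ring_nf
  have hp : (1 : ℝ) + Real.exp t ≠ 0 := by positivity
  have hp' : (1 : ℂ) + Complex.exp t ≠ 0 := by exact_mod_cast hp
  rw [bbG, bbG, Complex.cosh, Complex.cosh]
  push_cast
  rw [mul_neg, Complex.exp_neg, Complex.exp_neg, Complex.exp_neg, Complex.exp_neg, e2, e1]
  rw [e1] at hp'
  have n1 := Complex.exp_ne_zero ((s - 1 / 2) * t)
  have n2 := Complex.exp_ne_zero (t / 2 : ℂ)
  generalize Complex.exp ((s - 1 / 2) * t) = a at *
  generalize Complex.exp (t / 2 : ℂ) = b at *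
  have hb : 1 + b ^ 2 ≠ 0 := by rwa [pow_two]
  have hb' : b ^ 2 + 1 ≠ 0 := by rwa [add_comm]
  have hb3 : b + b⁻¹ ≠ 0 := by
    intro h; apply hb; field_simp at h; linear_combination h
  have hb4 : 1 + (b * b)⁻¹ ≠ 0 := by
    intro h; apply hb; field_simp at h; linear_combination h
  field_simp
  ring

lemma bb_half (s : ℂ) (h0 : 0 < s.re) (h1 : s.re < 1) :
    IntegrableOn (fun t : ℝ => Complex.cosh ((s - 1 / 2) * t) / Complex.cosh (t / 2))
      (Set.Ioi 0) ∧
    ∫ t in Set.Ioi (0 : ℝ), Complex.cosh ((s - 1 / 2) * t) / Complex.cosh (t / 2)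
      = Real.pi / Complex.sin (Real.pi * s) := by
  obtain ⟨hI, hv⟩ := bb_line s h0 h1
  have hn : Integrable (fun t => bbG s (-t)) := hI.comp_neg
  simp only [← bb_cosh]
  refine ⟨(hI.add hn).integrableOn, ?_⟩
  rw [integral_add hI.integrableOn hn.integrableOn, integral_comp_neg_Ioi, neg_zero, add_comm,
    intervalIntegral.integral_Iic_add_Ioi hI.integrableOn hI.integrableOn, hv]

lemma bb_cos_point (α k t : ℝ) :
    ((Real.cosh ((α - 1 / 2) * t) / Real.cosh (t / 2) * Real.cos (k * t) : ℝ) : ℂ) =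
    (1 / 2 : ℂ) * (Complex.cosh (((α + k * Complex.I) - 1 / 2) * t) / Complex.cosh (t / 2)
      + Complex.cosh (((α - k * Complex.I) - 1 / 2) * t) / Complex.cosh (t / 2)) := by
  have e1 : ((α + k * Complex.I) - 1 / 2) * t = ((α : ℂ) - 1 / 2) * t + (k * t) * Complex.I := by
    ring
  have e2 : ((α - k * Complex.I) - 1 / 2) * t = ((α : ℂ) - 1 / 2) * t - (k * t) * Complex.I := by
    ring
  rw [e1, e2, Complex.cosh_add, Complex.cosh_sub, Complex.cosh_mul_I]
  push_cast
  ring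

lemma bb_cos (α : ℝ) (hα : α ∈ Set.Ioo (0 : ℝ) 1) (k : ℝ) :
    ((∫ t in Set.Ioi (0 : ℝ),
      Real.cosh ((α - 1 / 2) * t) / Real.cosh (t / 2) * Real.cos (k * t) : ℝ) : ℂ)
    = (1 / 2 : ℂ) * (Real.pi / Complex.sin (Real.pi * (α + k * Complex.I)) +
        Real.pi / Complex.sin (Real.pi * (α - k * Complex.I))) := by
  obtain ⟨i1, v1⟩ := bb_half (α + k * Complex.I) (by simpa using hα.1) (by simpa using hα.2)
  obtain ⟨i2, v2⟩ := bb_half (α - k * Complex.I) (by simpa using hα.1) (by simpa using hα.2)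
  rw [← integral_complex_ofReal]
  simp only [bb_cos_point]
  rw [integral_const_mul, integral_add i1 i2, v1, v2]

lemma bb_bound (α : ℝ) (hα : α ∈ Set.Ioo (0 : ℝ) 1) :
    IntegrableOn (fun t : ℝ => Real.cosh ((α - 1 / 2) * t) / Real.cosh (t / 2)) (Set.Ioi 0) := by
  obtain ⟨i1, -⟩ := bb_half α (by simpa using hα.1) (by simpa using hα.2)
  have := i1.re
  refine this.congr (Filter.Eventually.of_forall fun t => ?_)
  have : Complex.cosh (((α : ℂ) - 1 / 2) * t) / Complex.cosh (t / 2) =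
    ((Real.cosh ((α - 1 / 2) * t) / Real.cosh (t / 2) : ℝ) : ℂ) := by push_cast; rfl
  simp only [this]
  exact Complex.ofReal_re _

lemma bb_integrable (α : ℝ) (hα : α ∈ Set.Ioo (0 : ℝ) 1) (θ : ℝ) :
    IntegrableOn
      (fun t : ℝ => Real.cosh ((α - 1 / 2) * t) / (t * Real.cosh (t / 2)) *
        Real.sin (θ * t / Real.pi)) (Set.Ioi 0) := by
  refine ((bb_bound α hα).const_mul (|θ| / Real.pi)).mono' ?_ ?_
  · exact Measurable.aestronglyMeasurable (by fun_prop)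
  · refine (ae_restrict_iff' measurableSet_Ioi).2 (Filter.Eventually.of_forall fun t ht => ?_)
    have ht : 0 < t := ht
    have c1 := Real.cosh_pos ((α - 1 / 2) * t)
    have c2 := Real.cosh_pos (t / 2)
    have hs : |Real.sin (θ * t / Real.pi)| ≤ |θ| * t / Real.pi := by
      refine (Real.abs_sin_le_abs).trans (le_of_eq ?_)
      rw [abs_div, abs_mul, abs_of_pos ht, abs_of_pos Real.pi_pos]
    rw [Real.norm_eq_abs, abs_mul, abs_of_pos (by positivity)]
    calc _ ≤ Real.cosh ((α - 1 / 2) * t) / (t * Real.cosh (t / 2)) * (|θ| * t / Real.pi) := by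
          gcongr
      _ = _ := by
          have := Real.pi_pos
          field_simp

lemma bb_deriv (α : ℝ) (hα : α ∈ Set.Ioo (0 : ℝ) 1) (θ : ℝ) :
    HasDerivAt (fun θ : ℝ => ∫ t in Set.Ioi (0 : ℝ),
      Real.cosh ((α - 1 / 2) * t) / (t * Real.cosh (t / 2)) * Real.sin (θ * t / Real.pi))
    ((1 / Real.pi) * ∫ t in Set.Ioi (0 : ℝ),
      Real.cosh ((α - 1 / 2) * t) / Real.cosh (t / 2) * Real.cos (θ / Real.pi * t)) θ := by
  rw [← integral_const_mul]
  refine (hasDerivAt_integral_of_dominated_loc_of_deriv_le (s := Set.univ) Filter.univ_mem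
    (F := fun θ t => Real.cosh ((α - 1 / 2) * t) / (t * Real.cosh (t / 2)) *
      Real.sin (θ * t / Real.pi))
    (F' := fun θ t => (1 / Real.pi) *
      (Real.cosh ((α - 1 / 2) * t) / Real.cosh (t / 2) * Real.cos (θ / Real.pi * t)))
    (bound := fun t => (1 / Real.pi) * (Real.cosh ((α - 1 / 2) * t) / Real.cosh (t / 2)))
    ?_ (bb_integrable α hα θ) ?_ ?_ ((bb_bound α hα).const_mul _) ?_).2
  · exact Filter.Eventually.of_forall fun x => Measurable.aestronglyMeasurable (by fun_prop)
  · exact Measurable.aestronglyMeasurable (by fun_prop)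
  · refine Filter.Eventually.of_forall fun t x _ => ?_
    have c1 := Real.cosh_pos ((α - 1 / 2) * t)
    have c2 := Real.cosh_pos (t / 2)
    have c3 := Real.pi_pos
    rw [Real.norm_eq_abs, abs_mul, abs_mul, abs_of_pos (by positivity : 0 < 1 / Real.pi),
      abs_of_pos (by positivity : 0 < Real.cosh ((α - 1 / 2) * t) / Real.cosh (t / 2))]
    gcongr
    exact mul_le_of_le_one_right (by positivity) (Real.abs_cos_le_one _)
  · refine (ae_restrict_iff' measurableSet_Ioi).2 (Filter.Eventually.of_forall fun t ht x _ => ?_)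
    have ht : 0 < t := ht
    have c2 := Real.cosh_pos (t / 2)
    have c3 := Real.pi_pos
    have h := (((hasDerivAt_id x).mul_const t).div_const Real.pi).sin.const_mul
      (Real.cosh ((α - 1 / 2) * t) / (t * Real.cosh (t / 2)))
    refine h.congr_deriv ?_
    simp only [id]
    rw [show x * t / Real.pi = x / Real.pi * t by ring]
    field_simp

lemma bb_sinh_ne (α : ℝ) (hα : α ∈ Set.Ioo (0 : ℝ) 1) (θ : ℝ) :
    Complex.sinh ((θ : ℂ) + Complex.I * Real.pi * α) ≠ 0 := by
  have hs : 0 < Real.sin (Real.pi * α) :=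
    Real.sin_pos_of_pos_of_lt_pi (mul_pos Real.pi_pos hα.1) (by nlinarith [Real.pi_pos, hα.2])
  intro h
  have h2 := congrArg Complex.im h
  rw [show (θ : ℂ) + Complex.I * Real.pi * α = (θ : ℂ) + ((Real.pi * α : ℝ) : ℂ) * Complex.I by
    push_cast; ring, Complex.sinh_add, Complex.cosh_mul_I, Complex.sinh_mul_I,
    ← Complex.ofReal_sinh, ← Complex.ofReal_cosh, ← Complex.ofReal_sin, ← Complex.ofReal_cos] at h2
  simp [-Complex.ofReal_sinh, -Complex.ofReal_cosh, -Complex.ofReal_sin, -Complex.ofReal_cos,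
    -Complex.ofReal_mul] at h2
  rcases h2 with h2 | h2
  · exact (Real.cosh_pos θ).ne' h2
  · exact hs.ne' h2

lemma bb_sinh_ne' (α : ℝ) (hα : α ∈ Set.Ioo (0 : ℝ) 1) (θ : ℝ) :
    Complex.sinh ((θ : ℂ) - Complex.I * Real.pi * α) ≠ 0 := by
  have := bb_sinh_ne α hα (-θ)
  rw [show (θ : ℂ) - Complex.I * Real.pi * α = -(((-θ : ℝ) : ℂ) + Complex.I * Real.pi * α) by
    push_cast; ring, Complex.sinh_neg]
  exact neg_ne_zero.2 this

lemma bb_ne_of {z : ℂ} (h : Complex.sinh z ≠ 0) :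
    Complex.sinh (z / 2) ≠ 0 ∧ Complex.cosh (z / 2) ≠ 0 ∧
    Complex.sinh z = 2 * Complex.sinh (z / 2) * Complex.cosh (z / 2) := by
  have e : Complex.sinh z = 2 * Complex.sinh (z / 2) * Complex.cosh (z / 2) := by
    rw [← Complex.sinh_two_mul]; congr 1; ring
  refine ⟨fun h0 => h ?_, fun h0 => h ?_, e⟩ <;> rw [e, h0] <;> ring

/-- integral representation of the S-matrix building block for real
rapidity: `f_α(θ) = −exp(−2i ∫₀^∞ cosh((α−½)t)/(t·cosh(t/2)) · sin(θt/π) dt)`,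
the integral being absolutely convergent. -/
theorem building_block_integral_representation (α : ℝ) (hα : α ∈ Set.Ioo (0 : ℝ) 1)
    (θ : ℝ) :
    IntegrableOn
      (fun t : ℝ => Real.cosh ((α - 1 / 2) * t) / (t * Real.cosh (t / 2)) *
        Real.sin (θ * t / Real.pi)) (Set.Ioi 0) ∧
    Complex.tanh (((θ : ℂ) + Complex.I * (Real.pi : ℂ) * (α : ℂ)) / 2) /
        Complex.tanh (((θ : ℂ) - Complex.I * (Real.pi : ℂ) * (α : ℂ)) / 2)
      = -Complex.exp (-2 * Complex.I *
          ((∫ t in Set.Ioi (0 : ℝ),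
            Real.cosh ((α - 1 / 2) * t) / (t * Real.cosh (t / 2)) *
              Real.sin (θ * t / Real.pi) : ℝ) : ℂ)) := by
  refine ⟨bb_integrable α hα θ, ?_⟩
  set G : ℝ → ℝ := fun θ => ∫ t in Set.Ioi (0 : ℝ),
      Real.cosh ((α - 1 / 2) * t) / (t * Real.cosh (t / 2)) * Real.sin (θ * t / Real.pi) with hG
  let A : ℝ → ℂ := fun x => ((x : ℂ) + Complex.I * Real.pi * α) / 2
  let B : ℝ → ℂ := fun x => ((x : ℂ) - Complex.I * Real.pi * α) / 2
  let h : ℝ → ℂ := fun x => (Complex.sinh (A x) * Complex.cosh (B x)) /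
    (Complex.cosh (A x) * Complex.sinh (B x)) * Complex.exp (2 * Complex.I * (G x : ℂ))
  have hder : ∀ x, HasDerivAt h 0 x := by
    intro x
    obtain ⟨a1, a2, a3⟩ := bb_ne_of (bb_sinh_ne α hα x)
    obtain ⟨b1, b2, b3⟩ := bb_ne_of (bb_sinh_ne' α hα x)
    have dA : HasDerivAt A (1 / 2) x :=
      (((hasDerivAt_id x).ofReal_comp).add_const _).div_const 2
    have dB : HasDerivAt B (1 / 2) x :=
      (((hasDerivAt_id x).ofReal_comp).sub_const _).div_const 2
    have dG : HasDerivAt (fun x => (G x : ℂ)) _ x := (bb_deriv α hα x).ofReal_comp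
    have sA : HasDerivAt (fun x => Complex.sinh (A x)) (Complex.cosh (A x) * (1 / 2)) x :=
      (Complex.hasDerivAt_sinh _).comp x dA
    have cA : HasDerivAt (fun x => Complex.cosh (A x)) (Complex.sinh (A x) * (1 / 2)) x :=
      (Complex.hasDerivAt_cosh _).comp x dA
    have sB : HasDerivAt (fun x => Complex.sinh (B x)) (Complex.cosh (B x) * (1 / 2)) x :=
      (Complex.hasDerivAt_sinh _).comp x dB
    have cB : HasDerivAt (fun x => Complex.cosh (B x)) (Complex.sinh (B x) * (1 / 2)) x :=
      (Complex.hasDerivAt_cosh _).comp x dB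
    have eE : HasDerivAt (fun x => Complex.exp (2 * Complex.I * (G x : ℂ))) _ x :=
      (Complex.hasDerivAt_exp _).comp x (dG.const_mul (2 * Complex.I))
    have key := ((sA.mul cB).div (cA.mul sB) (mul_ne_zero a2 b1)).mul eE
    refine key.congr_deriv ?_
    have hpi : (Real.pi : ℂ) ≠ 0 := by exact_mod_cast Real.pi_ne_zero
    have s1 : Complex.sin (Real.pi * (α + ((x / Real.pi : ℝ) : ℂ) * Complex.I)) =
        Complex.I * Complex.sinh ((x : ℂ) - Complex.I * Real.pi * α) := by
      have e : (x : ℂ) - Complex.I * Real.pi * α =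
          -(Real.pi * (α + ((x / Real.pi : ℝ) : ℂ) * Complex.I)) * Complex.I := by
        push_cast
        field_simp
        ring_nf
        simp
        try ring
      rw [e, Complex.sinh_mul_I, Complex.sin_neg]
      linear_combination Complex.sin (Real.pi * (α + ((x / Real.pi : ℝ) : ℂ) * Complex.I)) *
        Complex.I_mul_I
    have s2 : Complex.sin (Real.pi * (α - ((x / Real.pi : ℝ) : ℂ) * Complex.I)) =
        -Complex.I * Complex.sinh ((x : ℂ) + Complex.I * Real.pi * α) := by
      have e : (x : ℂ) + Complex.I * Real.pi * α =
          (Real.pi * (α - ((x / Real.pi : ℝ) : ℂ) * Complex.I)) * Complex.I := by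
        push_cast
        field_simp
        ring_nf
        simp
        try ring
      rw [e, Complex.sinh_mul_I]
      linear_combination Complex.sin (Real.pi * (α - ((x / Real.pi : ℝ) : ℂ) * Complex.I)) *
        Complex.I_mul_I
    rw [Complex.ofReal_mul, bb_cos α hα, s1, s2, a3, b3]
    have qA := Complex.cosh_sq (A x)
    have qB := Complex.cosh_sq (B x)
    change Complex.sinh (A x) ≠ 0 at a1
    change Complex.cosh (A x) ≠ 0 at a2
    change Complex.sinh (B x) ≠ 0 at b1
    change Complex.cosh (B x) ≠ 0 at b2
    simp only [Pi.mul_apply, Pi.div_apply]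
    change _ + Complex.sinh (A x) * Complex.cosh (B x) / (Complex.cosh (A x) * Complex.sinh (B x)) *
      (_ * (2 * Complex.I * (_ * (1 / 2 * (Real.pi / (Complex.I * (2 * Complex.sinh (B x) *
        Complex.cosh (B x))) + Real.pi / (-Complex.I * (2 * Complex.sinh (A x) *
        Complex.cosh (A x)))))))) = 0
    push_cast
    have hI := Complex.I_ne_zero
    generalize Complex.sinh (A x) = a at *
    generalize Complex.cosh (A x) = b at *
    generalize Complex.sinh (B x) = c at *
    generalize Complex.cosh (B x) = d at *
    generalize Complex.exp _ = E at *
    field_simp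
    linear_combination E * c * d * qA - E * a * b * qB
  have hconst : h θ = h 0 :=
    is_const_of_deriv_eq_zero (fun x => (hder x).differentiableAt) (fun x => (hder x).deriv) θ 0
  have h0 : h 0 = -1 := by
    obtain ⟨a1, a2, -⟩ := bb_ne_of (bb_sinh_ne α hα 0)
    have hB : B 0 = -A 0 := by simp only [A, B]; push_cast; ring
    change Complex.sinh (A 0) ≠ 0 at a1
    change Complex.cosh (A 0) ≠ 0 at a2
    have hG0 : G 0 = 0 := by simp [hG]
    simp only [h]
    rw [hB, hG0, Complex.sinh_neg, Complex.cosh_neg]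
    simp only [Complex.ofReal_zero, mul_zero, Complex.exp_zero]
    field_simp
  obtain ⟨a1, a2, -⟩ := bb_ne_of (bb_sinh_ne α hα θ)
  obtain ⟨b1, b2, -⟩ := bb_ne_of (bb_sinh_ne' α hα θ)
  rw [h0] at hconst
  change _ = -Complex.exp (-2 * Complex.I * (G θ : ℂ))
  have hE := Complex.exp_ne_zero (2 * Complex.I * (G θ : ℂ))
  rw [show -2 * Complex.I * (G θ : ℂ) = -(2 * Complex.I * (G θ : ℂ)) by ring, Complex.exp_neg,
    Complex.tanh_eq_sinh_div_cosh, Complex.tanh_eq_sinh_div_cosh, div_div_div_eq]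
  change Complex.sinh (A θ) * Complex.cosh (B θ) / (Complex.cosh (A θ) * Complex.sinh (B θ)) = _
  rw [← div_eq_one_iff_eq (neg_ne_zero.2 (inv_ne_zero hE)), div_neg, div_inv_eq_mul]
  change -(h θ) = 1
  rw [hconst, neg_neg]
end

section
/- For every α ∈ (−1,1) and every real x, 4 ∫₀^∞ cosh(αt) · sin²(x t/(2π)) / (t · sinh t) dt = log( (cosh x + cos(πα)) / (1 + cos(πα)) ), where the integral is an absolutely convergent Lebesgue integral over (0,∞). -/
open MeasureTheory

open Filter Topology in
lemma cos_prod_aux (z : ℂ) (hz : Complex.sin (Real.pi * (z / 2)) ≠ 0) :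
    Tendsto (fun N : ℕ => ∏ j ∈ Finset.range N, ((1 : ℂ) - z ^ 2 / (2 * (j : ℂ) + 1) ^ 2))
      atTop (𝓝 (Complex.cos (Real.pi * (z / 2)))) := by
  have h1 := (Complex.tendsto_euler_sin_prod z).comp
    (tendsto_id.const_mul_atTop' (show (0:ℕ) < 2 by norm_num))
  have h2 := Complex.tendsto_euler_sin_prod (z / 2)
  have h3 := h1.div (h2.const_mul 2) (by simpa using hz)
  have hev : ∀ᶠ n : ℕ in atTop, (Real.pi * (z / 2) * ∏ j ∈ Finset.range n,
      ((1 : ℂ) - (z / 2) ^ 2 / ((j : ℂ) + 1) ^ 2)) ≠ 0 := h2.eventually_ne hz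
  have e : Complex.sin (Real.pi * z) / (2 * Complex.sin (Real.pi * (z / 2)))
      = Complex.cos (Real.pi * (z / 2)) := by
    have : (Real.pi : ℂ) * z = 2 * (Real.pi * (z / 2)) := by ring
    rw [this, Complex.sin_two_mul, div_eq_iff (mul_ne_zero two_ne_zero hz)]
    ring
  rw [e] at h3
  refine h3.congr' ?_
  filter_upwards [hev] with n hn
  have key : ∀ n : ℕ, ∏ j ∈ Finset.range (2 * n), ((1 : ℂ) - z ^ 2 / ((j : ℂ) + 1) ^ 2)
      = (∏ j ∈ Finset.range n, ((1 : ℂ) - (z / 2) ^ 2 / ((j : ℂ) + 1) ^ 2)) *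
        ∏ j ∈ Finset.range n, ((1 : ℂ) - z ^ 2 / (2 * (j : ℂ) + 1) ^ 2) := by
    intro n
    induction n with
    | zero => simp
    | succ k ih =>
      rw [show 2 * (k + 1) = 2 * k + 1 + 1 by ring, Finset.prod_range_succ, Finset.prod_range_succ,
        ih, Finset.prod_range_succ, Finset.prod_range_succ]
      have : (1 : ℂ) - z ^ 2 / (((2 * k + 1 : ℕ) : ℂ) + 1) ^ 2
          = (1 : ℂ) - (z / 2) ^ 2 / ((k : ℂ) + 1) ^ 2 := by
        push_cast
        rw [show (2 * (k:ℂ) + 1 + 1) = 2 * (k + 1) by ring, mul_pow, div_pow, div_div]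
      rw [this]
      push_cast
      ring
  simp only [Pi.div_apply, Function.comp_apply, id]
  rw [key n, div_eq_iff (by simpa using hn)]
  ring

open Filter Topology in
lemma prod_aux (α : ℝ) (hα : α ∈ Set.Ioo (-1 : ℝ) 1) (x : ℝ) (hx : 0 < x) :
    Tendsto (fun N : ℕ => ∏ n ∈ Finset.range N,
      ((1 + (x / Real.pi) ^ 2 / (2 * (n : ℝ) + 1 - α) ^ 2) *
       (1 + (x / Real.pi) ^ 2 / (2 * (n : ℝ) + 1 + α) ^ 2))) atTop
      (𝓝 ((Real.cosh x + Real.cos (Real.pi * α)) / (1 + Real.cos (Real.pi * α)))) := by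
  obtain ⟨h1, h2⟩ := hα
  have hpi := Real.pi_pos
  set y := x / Real.pi with hy
  have hxy : x = Real.pi * y := by rw [hy]; field_simp
  have hy0 : 0 < y := by positivity
  have hcosα : 0 < Real.cos (Real.pi * (α / 2)) :=
    Real.cos_pos_of_mem_Ioo ⟨by nlinarith, by nlinarith⟩
  -- complex product
  have hz : Complex.sin (Real.pi * (((α : ℂ) + y * Complex.I) / 2)) ≠ 0 := by
    intro h
    rw [Complex.sin_eq_zero_iff] at h
    obtain ⟨k, hk⟩ := h
    have := congrArg Complex.im hk
    simp at this
    exact hy0.ne' this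
  have hP := cos_prod_aux _ hz
  have hPn := (Complex.continuous_normSq.tendsto _).comp hP
  -- real product
  have hQ : Tendsto (fun N : ℕ => ∏ j ∈ Finset.range N, ((1 : ℂ) - (α : ℂ) ^ 2 / (2 * (j : ℂ) + 1) ^ 2))
      atTop (𝓝 (Complex.cos (Real.pi * ((α : ℂ) / 2)))) := by
    by_cases h0 : α = 0
    · simp [h0]
    · apply cos_prod_aux
      intro h
      have h' : Real.sin (Real.pi * (α / 2)) = 0 := by exact_mod_cast h
      rw [Real.sin_eq_zero_iff_of_lt_of_lt (by nlinarith) (by nlinarith)] at h'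
      have : α / 2 = 0 := by
        rcases mul_eq_zero.1 h' with h | h
        · linarith
        · exact h
      apply h0; linarith
  have hQn := (Complex.continuous_normSq.tendsto _).comp hQ
  have hQ0 : Complex.normSq (Complex.cos (Real.pi * ((α : ℂ) / 2))) = Real.cos (Real.pi * (α / 2)) ^ 2 := by
    have : Complex.cos (Real.pi * ((α : ℂ) / 2)) = ((Real.cos (Real.pi * (α / 2)) : ℝ) : ℂ) := by
      push_cast; rfl
    rw [this, Complex.normSq_ofReal]; ring
  have hP0 : Complex.normSq (Complex.cos (Real.pi * (((α : ℂ) + y * Complex.I) / 2)))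
      = (Real.cosh x + Real.cos (Real.pi * α)) / 2 := by
    have e1 : (Real.pi * (((α : ℂ) + y * Complex.I) / 2))
      = ((Real.pi * (α / 2) : ℝ) : ℂ) + ((x / 2 : ℝ) : ℂ) * Complex.I := by
      rw [hxy]; push_cast; ring
    rw [e1, Complex.cos_add_mul_I, ← Complex.ofReal_cos, ← Complex.ofReal_sin, ← Complex.ofReal_cosh,
      ← Complex.ofReal_sinh, Complex.normSq_apply]
    have e2 : Real.cosh x = 2 * Real.cosh (x / 2) ^ 2 - 1 := by
      have := Real.cosh_two_mul (x / 2)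
      rw [show 2 * (x / 2) = x by ring] at this
      rw [this, Real.sinh_sq]; ring
    have e3 : Real.cos (Real.pi * α) = 2 * Real.cos (Real.pi * (α / 2)) ^ 2 - 1 := by
      rw [← Real.cos_two_mul]; congr 1; ring
    simp only [Complex.sub_re, Complex.sub_im, Complex.mul_re, Complex.mul_im, Complex.ofReal_re,
      Complex.ofReal_im, Complex.I_re, Complex.I_im]
    rw [e2, e3]
    have e4 := Real.sinh_sq (x / 2)
    have e5 := Real.sin_sq (Real.pi * (α / 2))
    ring_nf at e4 e5 ⊢
    rw [e4, e5]
    ring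
  have e3 : 1 + Real.cos (Real.pi * α) = 2 * Real.cos (Real.pi * (α / 2)) ^ 2 := by
    rw [show Real.pi * α = 2 * (Real.pi * (α / 2)) by ring, Real.cos_two_mul]; ring
  have hlim := hPn.div hQn (by rw [hQ0]; positivity)
  rw [hQ0, hP0, div_div, ← e3] at hlim
  refine hlim.congr ?_
  intro N
  simp only [Pi.div_apply, Function.comp_apply, map_prod]
  rw [← Finset.prod_div_distrib]
  refine Finset.prod_congr rfl fun n _ => ?_
  have hn : (0:ℝ) ≤ n := Nat.cast_nonneg n
  have a1 : 2 * (n : ℝ) + 1 - α ≠ 0 := by linarith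
  have a2 : 2 * (n : ℝ) + 1 + α ≠ 0 := by linarith
  have a3 : 2 * (n : ℝ) + 1 ≠ 0 := by linarith
  have a3' : 2 * (n : ℂ) + 1 ≠ 0 := by exact_mod_cast a3
  have f1 : (1 : ℂ) - ((α : ℂ) + y * Complex.I) ^ 2 / (2 * (n : ℂ) + 1) ^ 2
      = (((2 * (n:ℝ) + 1 - α : ℝ) : ℂ) + ((-y : ℝ) : ℂ) * Complex.I) *
        (((2 * (n:ℝ) + 1 + α : ℝ) : ℂ) + ((y : ℝ) : ℂ) * Complex.I) / (((2 * (n:ℝ) + 1) ^ 2 : ℝ) : ℂ) := by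
    push_cast
    field_simp
    ring
  have f2 : (1 : ℂ) - (α : ℂ) ^ 2 / (2 * (n : ℂ) + 1) ^ 2
      = (((2 * (n:ℝ) + 1 - α) * (2 * (n:ℝ) + 1 + α) / (2 * (n:ℝ) + 1) ^ 2 : ℝ) : ℂ) := by
    push_cast
    field_simp
    ring
  rw [f1, f2, map_div₀, map_mul, Complex.normSq_add_mul_I, Complex.normSq_add_mul_I,
    Complex.normSq_ofReal, Complex.normSq_ofReal]
  field_simp

lemma laplace_sin_aux (c s : ℝ) (hc : 0 < c) :
    ∫ t in Set.Ioi (0 : ℝ), Real.sin (2 * s * t) * Real.exp (-c * t) = 2 * s / (c ^ 2 + 4 * s ^ 2) := by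
  have hre : ((-c : ℂ) + (2 * s : ℝ) * Complex.I).re < 0 := by simp [hc]
  have h := integral_exp_mul_complex_Ioi hre 0
  have hi := integrableOn_exp_mul_complex_Ioi hre 0
  have h2 := integral_im (𝕜 := ℂ) hi
  rw [h] at h2
  have : ∀ t : ℝ, RCLike.im (Complex.exp (((-c : ℂ) + (2 * s : ℝ) * Complex.I) * t))
      = Real.sin (2 * s * t) * Real.exp (-c * t) := by
    intro t
    simp [Complex.exp_im]
    ring
  simp only [this] at h2
  rw [h2]
  have hd : c * c + 2 * s * (2 * s) ≠ 0 := by nlinarith [sq_nonneg s, mul_pos hc hc]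
  simp [Complex.div_im, Complex.normSq_apply]
  ring

lemma frullani_aux (c b : ℝ) (hc : 0 < c) (hb : 0 < b) :
    ∫ t in Set.Ioi (0 : ℝ), Real.sin (b * t) ^ 2 / t * Real.exp (-c * t)
      = 1 / 4 * Real.log (1 + 4 * b ^ 2 / c ^ 2) := by
  have hint : Integrable (Function.uncurry fun (t s : ℝ) => Real.sin (2 * s * t) * Real.exp (-c * t))
      ((volume.restrict (Set.Ioi (0:ℝ))).prod (volume.restrict (Set.Ioc (0:ℝ) b))) := by
    have h1 : Integrable (fun t : ℝ => Real.exp (-c * t)) (volume.restrict (Set.Ioi (0:ℝ))) :=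
      integrableOn_exp_mul_Ioi (by linarith) 0
    have h2 : Integrable (fun _ : ℝ => (1:ℝ)) (volume.restrict (Set.Ioc (0:ℝ) b)) :=
      integrable_const _
    refine (h1.mul_prod h2).mono' ?_ ?_
    · apply Continuous.aestronglyMeasurable
      unfold Function.uncurry
      fun_prop
    · refine Filter.Eventually.of_forall fun p => ?_
      simp only [Function.uncurry, norm_mul, Real.norm_eq_abs, Real.abs_exp, mul_one]
      exact mul_le_of_le_one_left (Real.exp_pos _).le (Real.abs_sin_le_one _)
  have hswap := integral_integral_swap hint
  have hL : ∀ t ∈ Set.Ioi (0:ℝ), ∫ s in Set.Ioc (0:ℝ) b, Real.sin (2 * s * t) * Real.exp (-c * t)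
      = Real.sin (b * t) ^ 2 / t * Real.exp (-c * t) := by
    intro t ht
    have ht' : t ≠ 0 := ne_of_gt ht
    rw [integral_mul_const, ← intervalIntegral.integral_of_le hb.le]
    congr 1
    rw [intervalIntegral.integral_eq_sub_of_hasDerivAt (f := fun s => Real.sin (s * t) ^ 2 / t)]
    · simp
    · intro s _
      have := ((((hasDerivAt_id s).mul_const t).sin).pow 2).div_const t
      convert! this using 1
      rw [show 2 * s * t = 2 * (s * t) by ring, Real.sin_two_mul]
      simp
      field_simp
    · apply Continuous.intervalIntegrable; fun_prop
  rw [setIntegral_congr_fun measurableSet_Ioi hL] at hswap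
  rw [hswap]
  simp only [laplace_sin_aux c _ hc]
  rw [← intervalIntegral.integral_of_le hb.le]
  have hpos : ∀ s : ℝ, 0 < c ^ 2 + 4 * s ^ 2 := fun s => by positivity
  rw [intervalIntegral.integral_eq_sub_of_hasDerivAt
    (f := fun s => 1 / 4 * Real.log (c ^ 2 + 4 * s ^ 2))]
  · rw [← mul_sub, ← Real.log_div (hpos _).ne' (hpos _).ne']
    congr 2
    field_simp
    simp
  · intro s _
    have h0 : HasDerivAt (fun s : ℝ => c ^ 2 + 4 * s ^ 2) (4 * (2 * s)) s := by
      have := ((hasDerivAt_pow 2 s).const_mul 4).const_add (c ^ 2)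
      simpa using this
    have := (h0.log (hpos s).ne').const_mul (1 / 4)
    convert! this using 1
    have := (hpos s).ne'
    field_simp
  · apply Continuous.intervalIntegrable
    exact (by fun_prop : Continuous fun s : ℝ => 2 * s).div (by fun_prop) fun s => (hpos s).ne'

lemma frullani_int_aux (c b : ℝ) (hc : 0 < c) (hb : 0 < b) :
    IntegrableOn (fun t : ℝ => Real.sin (b * t) ^ 2 / t * Real.exp (-c * t)) (Set.Ioi 0) := by
  by_contra h
  have h1 := frullani_aux c b hc hb
  rw [integral_undef h] at h1
  have : 0 < Real.log (1 + 4 * b ^ 2 / c ^ 2) := Real.log_pos (by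
    have : 0 < 4 * b ^ 2 / c ^ 2 := by positivity
    linarith)
  linarith

lemma inv_sinh_aux (t : ℝ) (ht : 0 < t) :
    HasSum (fun n : ℕ => 2 * Real.exp (-(2 * (n:ℝ) + 1) * t)) (1 / Real.sinh t) := by
  have hlt : Real.exp (-2 * t) < 1 := Real.exp_zero ▸ Real.exp_lt_exp.2 (by linarith)
  have h := (hasSum_geometric_of_lt_one (Real.exp_pos (-2 * t)).le hlt).mul_left (2 * Real.exp (-t))
  convert! h using 1
  · ext n
    rw [← Real.exp_nat_mul, mul_assoc, ← Real.exp_add]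
    congr 2; ring
  · have hs : Real.sinh t ≠ 0 := (Real.sinh_pos_iff.2 ht).ne'
    have h1 : 1 - Real.exp (-2 * t) ≠ 0 := by linarith
    rw [← div_eq_mul_inv, div_eq_div_iff hs h1, Real.sinh_eq, show -2 * t = -t + -t by ring, Real.exp_add]
    have : Real.exp (-t) * Real.exp t = 1 := by rw [← Real.exp_add]; simp
    linear_combination (-1 : ℝ) * this

lemma main_pos_aux
    (α : ℝ) (hα : α ∈ Set.Ioo (-1 : ℝ) 1) (x : ℝ) (hx : 0 < x) :
    IntegrableOn
      (fun t : ℝ => Real.cosh (α * t) * Real.sin (x * t / (2 * Real.pi)) ^ 2 /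
        (t * Real.sinh t)) (Set.Ioi 0) ∧
    4 * ∫ t in Set.Ioi (0 : ℝ),
        Real.cosh (α * t) * Real.sin (x * t / (2 * Real.pi)) ^ 2 / (t * Real.sinh t)
      = Real.log ((Real.cosh x + Real.cos (Real.pi * α)) / (1 + Real.cos (Real.pi * α))) := by
  have hP := prod_aux α hα x hx
  obtain ⟨h1, h2⟩ := hα
  have hpi := Real.pi_pos
  set L := (Real.cosh x + Real.cos (Real.pi * α)) / (1 + Real.cos (Real.pi * α)) with hL
  have hden : 0 < 1 + Real.cos (Real.pi * α) := by
    have : 0 < Real.cos (Real.pi * (α / 2)) :=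
      Real.cos_pos_of_mem_Ioo ⟨by nlinarith, by nlinarith⟩
    rw [show Real.pi * α = 2 * (Real.pi * (α / 2)) by ring, Real.cos_two_mul]
    nlinarith [pow_pos this 2]
  have hL1 : 1 < L := by
    rw [hL, one_lt_div hden]
    have := Real.one_lt_cosh.2 hx.ne'
    linarith
  set b := x / (2 * Real.pi) with hb
  have hb0 : 0 < b := by positivity
  have hb2 : 4 * b ^ 2 = (x / Real.pi) ^ 2 := by rw [hb]; field_simp; norm_num
  set F : ℕ → ℝ → ℝ := fun n t => Real.sin (b * t) ^ 2 / t * Real.exp (-(2 * (n:ℝ) + 1 - α) * t)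
    + Real.sin (b * t) ^ 2 / t * Real.exp (-(2 * (n:ℝ) + 1 + α) * t) with hF
  have p1 : ∀ n : ℕ, 0 < 2 * (n:ℝ) + 1 - α := fun n => by
    have : (0:ℝ) ≤ n := Nat.cast_nonneg n
    linarith
  have p2 : ∀ n : ℕ, 0 < 2 * (n:ℝ) + 1 + α := fun n => by
    have : (0:ℝ) ≤ n := Nat.cast_nonneg n
    linarith
  have hFi : ∀ n, Integrable (F n) (volume.restrict (Set.Ioi (0:ℝ))) := fun n =>
    (frullani_int_aux _ b (p1 n) hb0).add (frullani_int_aux _ b (p2 n) hb0)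
  set u : ℕ → ℝ := fun n => (1 + (x / Real.pi) ^ 2 / (2 * (n : ℝ) + 1 - α) ^ 2) *
       (1 + (x / Real.pi) ^ 2 / (2 * (n : ℝ) + 1 + α) ^ 2) with hu
  have q : ∀ r : ℝ, 0 < r → 1 < 1 + (x / Real.pi) ^ 2 / r ^ 2 := fun r hr => by
    have : 0 < (x / Real.pi) ^ 2 / r ^ 2 := by positivity
    linarith
  have hu1 : ∀ n, 1 ≤ u n := fun n => one_le_mul_of_one_le_of_one_le (q _ (p1 n)).le (q _ (p2 n)).le
  have hFv : ∀ n, ∫ t in Set.Ioi (0:ℝ), F n t = 1 / 4 * Real.log (u n) := by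
    intro n
    have := integral_add (frullani_int_aux _ b (p1 n) hb0) (frullani_int_aux _ b (p2 n) hb0)
    rw [frullani_aux _ b (p1 n) hb0, frullani_aux _ b (p2 n) hb0, hb2, ← mul_add, ← Real.log_mul
      (by linarith [q _ (p1 n)]) (by linarith [q _ (p2 n)])] at this
    exact this
  have hsum : HasSum (fun n => 1 / 4 * Real.log (u n)) (1 / 4 * Real.log L) := by
    apply HasSum.mul_left
    rw [hasSum_iff_tendsto_nat_of_nonneg (fun n => Real.log_nonneg (hu1 n))]
    have := hP.log (by linarith : L ≠ 0)
    refine this.congr fun N => ?_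
    exact Real.log_prod fun n _ => by linarith [hu1 n]
  have hFnn : ∀ n, ∀ t ∈ Set.Ioi (0:ℝ), 0 ≤ F n t := by
    intro n t ht
    have : 0 < t := ht
    simp only [hF]
    positivity
  have hnorm : ∀ n, ∫ t in Set.Ioi (0:ℝ), ‖F n t‖ = 1 / 4 * Real.log (u n) := by
    intro n
    rw [← hFv n]
    exact setIntegral_congr_fun measurableSet_Ioi fun t ht => Real.norm_of_nonneg (hFnn n t ht)
  have hS := hasSum_integral_of_summable_integral_norm hFi (by simp only [hnorm]; exact hsum.summable)
  simp only [hFv] at hS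
  have hval := hS.unique hsum
  have hpt : ∀ t ∈ Set.Ioi (0:ℝ), ∑' n, F n t =
      Real.cosh (α * t) * Real.sin (x * t / (2 * Real.pi)) ^ 2 / (t * Real.sinh t) := by
    intro t ht
    have ht0 : (0:ℝ) < t := ht
    have h := (inv_sinh_aux t ht0).mul_left (Real.cosh (α * t) * (Real.sin (b * t) ^ 2 / t))
    have e : (fun n : ℕ => Real.cosh (α * t) * (Real.sin (b * t) ^ 2 / t) *
        (2 * Real.exp (-(2 * (n:ℝ) + 1) * t))) = fun n => F n t := by
      ext n
      simp only [hF]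
      rw [show -(2 * (n:ℝ) + 1 - α) * t = -(2 * (n:ℝ) + 1) * t + α * t by ring,
        show -(2 * (n:ℝ) + 1 + α) * t = -(2 * (n:ℝ) + 1) * t + -(α * t) by ring,
        Real.exp_add, Real.exp_add, Real.cosh_eq]
      ring
    rw [e] at h
    rw [h.tsum_eq, show b * t = x * t / (2 * Real.pi) by rw [hb]; ring]
    have := (Real.sinh_pos_iff.2 ht0).ne'
    field_simp
  rw [setIntegral_congr_fun measurableSet_Ioi hpt] at hval
  refine ⟨?_, by rw [hval]; ring⟩
  by_contra h
  rw [integral_undef h] at hval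
  linarith [Real.log_pos hL1]

/-- the building-block identity `g_α · g_{−α}` on the line `θ = x + iπ`:
`4∫₀^∞ cosh(αt)·sin²(xt/2π)/(t·sinh t) dt = log((cosh x + cos πα)/(1 + cos πα))`,
the integral being absolutely convergent. -/
theorem galpha_product_integral_identity (α : ℝ) (hα : α ∈ Set.Ioo (-1 : ℝ) 1) (x : ℝ) :
    IntegrableOn
      (fun t : ℝ => Real.cosh (α * t) * Real.sin (x * t / (2 * Real.pi)) ^ 2 /
        (t * Real.sinh t)) (Set.Ioi 0) ∧
    4 * ∫ t in Set.Ioi (0 : ℝ),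
        Real.cosh (α * t) * Real.sin (x * t / (2 * Real.pi)) ^ 2 / (t * Real.sinh t)
      = Real.log ((Real.cosh x + Real.cos (Real.pi * α)) / (1 + Real.cos (Real.pi * α))) := by
  rcases lt_trichotomy x 0 with hx | hx | hx
  · have h := main_pos_aux α hα (-x) (by linarith)
    simpa only [neg_mul, neg_div, Real.sin_neg, neg_sq, Real.cosh_neg] using h
  · subst hx
    simp
  · exact main_pos_aux α hα x hx
end

section
/- The number of partitions λ of 56 with all parts at most 8 and satisfying m₁(λ) ≤ 14, m₂(λ) ≤ 26, m₃(λ) ≤ 36, m₄(λ) ≤ 44, m₅(λ) ≤ 50, m₆(λ) ≤ 54 and m₇(λ) ≤ 56 equals 5302. -/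
open scoped Classical

/-- `m_k(λ) = Σ_i min(λ_i, k)`, the `k`-th partial degree of the monomial `σ_λ`. -/
def partitionPartialDeg {D : ℕ} (lam : Nat.Partition D) (k : ℕ) : ℕ :=
  (lam.parts.map fun p => min p k).sum

/-- The explicit multiset with prescribed multiplicities of the parts `8, …, 1`. -/
def blockMs (a b c d e f g h : ℕ) : Multiset ℕ :=
  Multiset.replicate a 8 + Multiset.replicate b 7 + Multiset.replicate c 6 +
  Multiset.replicate d 5 + Multiset.replicate e 4 + Multiset.replicate f 3 +
  Multiset.replicate g 2 + Multiset.replicate h 1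

theorem eq_blockMs (s : Multiset ℕ) (h0 : ∀ p ∈ s, 0 < p) (h8 : ∀ p ∈ s, p ≤ 8) :
    s = blockMs (s.count 8) (s.count 7) (s.count 6) (s.count 5) (s.count 4)
      (s.count 3) (s.count 2) (s.count 1) := by
  ext p
  unfold blockMs
  by_cases hp : p ∈ s
  · have h1 := h0 p hp
    have h2 := h8 p hp
    interval_cases p <;> simp [Multiset.count_replicate]
  · have : s.count p = 0 := Multiset.count_eq_zero.2 hp
    rw [this]
    simp only [Multiset.count_add, Multiset.count_replicate]
    split_ifs <;> subst_vars <;> omega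

theorem sum_min_blockMs (a b c d e f g h k : ℕ) :
    ((blockMs a b c d e f g h).map fun p => min p k).sum =
      a * min 8 k + b * min 7 k + c * min 6 k + d * min 5 k + e * min 4 k + f * min 3 k +
      g * min 2 k + h * min 1 k := by
  simp [blockMs]

theorem sum_blockMs (a b c d e f g h : ℕ) :
    (blockMs a b c d e f g h).sum =
      a * 8 + b * 7 + c * 6 + d * 5 + e * 4 + f * 3 + g * 2 + h := by
  simp [blockMs]

/-- Admissible multiplicities of the parts `8, …, 2` (that of `1` is determined). -/
def tuples : Finset (Σ _ : ℕ, Σ _ : ℕ, Σ _ : ℕ, Σ _ : ℕ, Σ _ : ℕ, Σ _ : ℕ, ℕ) :=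
  (Finset.range (56 / 8 + 1)).sigma fun a =>
  ((Finset.range ((56 - 8 * a) / 7 + 1)).filter fun b => 2 ≤ 2 * a + b).sigma fun b =>
  ((Finset.range ((56 - 8 * a - 7 * b) / 6 + 1)).filter fun c =>
    6 ≤ 3 * a + 2 * b + c).sigma fun c =>
  ((Finset.range ((56 - 8 * a - 7 * b - 6 * c) / 5 + 1)).filter fun d =>
    12 ≤ 4 * a + 3 * b + 2 * c + d).sigma fun d =>
  ((Finset.range ((56 - 8 * a - 7 * b - 6 * c - 5 * d) / 4 + 1)).filter fun e =>
    20 ≤ 5 * a + 4 * b + 3 * c + 2 * d + e).sigma fun e =>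
  ((Finset.range ((56 - 8 * a - 7 * b - 6 * c - 5 * d - 4 * e) / 3 + 1)).filter fun f =>
    30 ≤ 6 * a + 5 * b + 4 * c + 3 * d + 2 * e + f).sigma fun f =>
  (Finset.range ((56 - 8 * a - 7 * b - 6 * c - 5 * d - 4 * e - 3 * f) / 2 + 1)).filter fun g =>
    42 ≤ 7 * a + 6 * b + 5 * c + 4 * d + 3 * e + 2 * f + g

/-- A version of `∑ i ∈ range n, F i` that evaluates quickly in the kernel. -/
def sumTo (n : ℕ) (F : ℕ → ℕ) : ℕ :=
  Nat.rec 0 (fun i acc => Nat.add acc (F i)) n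

theorem sum_range_eq_sumTo (n : ℕ) (F : ℕ → ℕ) : ∑ i ∈ Finset.range n, F i = sumTo n F := by
  induction n with
  | zero => rfl
  | succ k ih => rw [Finset.sum_range_succ, ih]; rfl

theorem sum_filter_eq_sumTo (n k S : ℕ) (F : ℕ → ℕ) :
    ∑ i ∈ (Finset.range n).filter (fun i => k ≤ S + i), F i =
      sumTo n fun i => cond (Nat.ble k (S + i)) (F i) 0 := by
  rw [Finset.sum_filter, sum_range_eq_sumTo]
  congr 1
  funext i
  by_cases h : k ≤ S + i
  · rw [if_pos h, Nat.ble_eq_true_of_le h]; rfl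
  · rw [if_neg h, Bool.eq_false_iff.2 (fun h' => h (Nat.le_of_ble_eq_true h'))]; rfl

theorem card_filter_range (n k S : ℕ) :
    ((Finset.range n).filter (fun i => k ≤ S + i)).card = n - (k - S) := by
  have : (Finset.range n).filter (fun i => k ≤ S + i) = Finset.Ico (k - S) n := by
    ext i
    simp only [Finset.mem_filter, Finset.mem_range, Finset.mem_Ico]
    omega
  rw [this, Nat.card_Ico]

set_option maxRecDepth 100000 in
theorem card_tuples : tuples.card = 5302 := by
  unfold tuples
  simp only [Finset.card_sigma, card_filter_range, sum_filter_eq_sumTo, sum_range_eq_sumTo]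
  decide +kernel

theorem count_partitions_disorder_8particles :
    (Finset.univ.filter fun lam : Nat.Partition 56 =>
      (∀ p ∈ lam.parts, p ≤ 8) ∧
      partitionPartialDeg lam 1 ≤ 14 ∧
      partitionPartialDeg lam 2 ≤ 26 ∧
      partitionPartialDeg lam 3 ≤ 36 ∧
      partitionPartialDeg lam 4 ≤ 44 ∧
      partitionPartialDeg lam 5 ≤ 50 ∧
      partitionPartialDeg lam 6 ≤ 54 ∧
      partitionPartialDeg lam 7 ≤ 56).card = 5302 := by
  rw [← card_tuples]
  refine Finset.card_bij (fun lam _ => ⟨lam.parts.count 8, lam.parts.count 7, lam.parts.count 6,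
    lam.parts.count 5, lam.parts.count 4, lam.parts.count 3, lam.parts.count 2⟩) ?_ ?_ ?_
  · intro lam hl
    simp only [Finset.mem_filter, Finset.mem_univ, true_and] at hl
    simp only [partitionPartialDeg] at hl
    obtain ⟨h8, hl⟩ := hl
    have hs := lam.parts_sum
    have key := eq_blockMs lam.parts (fun p hp => lam.parts_pos hp) h8
    generalize lam.parts.count 8 = a, lam.parts.count 7 = b, lam.parts.count 6 = c,
      lam.parts.count 5 = d, lam.parts.count 4 = e, lam.parts.count 3 = f,
      lam.parts.count 2 = g, lam.parts.count 1 = h at key ⊢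
    rw [key] at hs hl
    simp only [sum_min_blockMs] at hl
    rw [sum_blockMs] at hs
    norm_num at hl
    simp only [tuples, Finset.mem_sigma, Finset.mem_filter, Finset.mem_range, and_assoc]
    refine ⟨?_, ?_, ?_, ?_, ?_, ?_, ?_, ?_, ?_, ?_, ?_, ?_, ?_⟩ <;> omega
  · intro l1 h1 l2 h2 heq
    simp only [Finset.mem_filter, Finset.mem_univ, true_and] at h1 h2
    have k1 := eq_blockMs l1.parts (fun p hp => l1.parts_pos hp) h1.1
    have k2 := eq_blockMs l2.parts (fun p hp => l2.parts_pos hp) h2.1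
    have s1 := l1.parts_sum
    have s2 := l2.parts_sum
    simp only [Sigma.mk.injEq, heq_eq_eq] at heq
    obtain ⟨e8, e7, e6, e5, e4, e3, e2⟩ := heq
    rw [e8, e7, e6, e5, e4, e3, e2] at k1
    have e1 : l1.parts.count 1 = l2.parts.count 1 := by
      rw [k1, sum_blockMs] at s1
      rw [k2, sum_blockMs] at s2
      omega
    rw [e1, ← k2] at k1
    exact Nat.Partition.ext k1
  · rintro ⟨a, b, c, d, e, f, g⟩ ht
    simp only [tuples, Finset.mem_sigma, Finset.mem_filter, Finset.mem_range, and_assoc] at ht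
    obtain ⟨t1, t2, u2, t3, u3, t4, u4, t5, u5, t6, u6, t7, u7⟩ := ht
    obtain ⟨h, hh⟩ : ∃ h, a * 8 + b * 7 + c * 6 + d * 5 + e * 4 + f * 3 + g * 2 + h = 56 :=
      ⟨56 - (a * 8 + b * 7 + c * 6 + d * 5 + e * 4 + f * 3 + g * 2), by omega⟩
    clear t1 t2 t3 t4 t5 t6 t7
    have hmem : ∀ p ∈ blockMs a b c d e f g h, 0 < p ∧ p ≤ 8 := by
      intro p hp
      simp only [blockMs, Multiset.mem_add, Multiset.mem_replicate] at hp
      omega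
    refine ⟨⟨blockMs a b c d e f g h, fun {p} hp => (hmem p hp).1,
      (sum_blockMs ..).trans hh⟩, ?_, ?_⟩
    · simp only [Finset.mem_filter, Finset.mem_univ, true_and]
      simp only [partitionPartialDeg, sum_min_blockMs]
      refine ⟨fun p hp => (hmem p hp).2, ?_⟩
      norm_num
      omega
    · simp [blockMs, Multiset.count_replicate]
end
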